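/- Lemma 3.1 (Coupling estimate for the second coordinate). Assume 0 < 2b₂ < a₁. Set C₁₁ = (a₁ − 2b₂)^{−1} ∫_G |z₂|² m(dz), C₁₂ = 8 max{α₂₁, α₂₂} / (a₁ − 2b₂), C₁ = 4 max{C₁₁, C₁₂}, and C₂ = |b₁| / (a₁ − b₂). Then for every t ≥ 0 and every x = (x₁,x₂), y = (y₁,y₂) ∈ G there exists a probability measure Q on G × G whose first marginal is P_t(x,·) and whose second marginal is P_t(y,·), such that ∫_{G×G} |ξ₂ − η₂| Q(dξ,dη) ≤ e^{−b₂ t} (|x₂ − y₂| + C₂ |x₁ − y₁| + √(C₁ |x₁ − y₁|)), and consequently, for every η > 0, Q({(ξ,η') ∈ G × G : |ξ₂ − η'₂| > e^{−b₂ t} η}) ≤ η^{−1} (|x₂ − y₂| + C₂ |x₁ − y₁| + √(C₁ |x₁ − y₁|)). -/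

import Mathlib

open MeasureTheory Filter Set Topology
open scoped ENNReal Classical

noncomputable section

namespace AffinePaper

/-- Total variation distance between two measures:
`‖μ - ν‖_var = sup {|∫ f dμ - ∫ f dν| : f measurable, |f| ≤ 1}`. -/
def tvDist {α : Type*} [MeasurableSpace α] (μ ν : Measure α) : ℝ :=
  ⨆ f : {f : α → ℝ // Measurable f ∧ ∀ x, |f x| ≤ 1},
    |(∫ x, f.1 x ∂μ) - ∫ x, f.1 x ∂ν|

/-- Translate of a measure on `ℝ` by `a`, i.e. `δ_a * σ`. -/
def translate (a : ℝ) (σ : Measure ℝ) : Measure ℝ := Measure.map (fun x => x + a) σ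

/-- The function `φ` of the affine process. -/
def phi (a₁ b₁ α₁₁ α₁₂ α₂₁ α₂₂ : ℝ) (m : Measure (ℝ × ℝ)) (u : ℂ × ℂ) : ℂ :=
  -(a₁ : ℂ) * u.1 - (b₁ : ℂ) * u.2 + ((α₁₁ : ℂ) + (α₁₂ : ℂ)) * u.1 ^ 2
    + 2 * ((Real.sqrt (α₁₁ * α₂₁) : ℂ) + (Real.sqrt (α₁₂ * α₂₂) : ℂ)) * u.1 * u.2
    + ((α₂₁ : ℂ) + (α₂₂ : ℂ)) * u.2 ^ 2
    + ∫ z : ℝ × ℝ,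
        (Complex.exp (u.1 * (z.1 : ℂ) + u.2 * (z.2 : ℂ)) - 1
          - (u.1 * (z.1 : ℂ) + u.2 * (z.2 : ℂ))) ∂m

/-- The function `ψ` of the affine process. -/
def psi (a₂ b₀ σ : ℝ) (n : Measure (ℝ × ℝ)) (u : ℂ × ℂ) : ℂ :=
  (a₂ : ℂ) * u.1 - (b₀ : ℂ) * u.2 + (σ : ℂ) ^ 2 / 2 * u.2 ^ 2
    + ∫ z : ℝ × ℝ,
        (Complex.exp (u.1 * (z.1 : ℂ) + u.2 * (z.2 : ℂ)) - 1 - (z.2 : ℂ) * u.2) ∂n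

/-- The branching mechanism `φ₀`. -/
def phi0 (a₁ α₁₁ α₁₂ : ℝ) (m : Measure (ℝ × ℝ)) (x : ℝ) : ℝ :=
  a₁ * x + (α₁₁ + α₁₂) * x ^ 2 + ∫ z : ℝ × ℝ, (Real.exp (-x * z.1) - 1 + x * z.1) ∂m

/-- Condition (A): Grey's condition. -/
def CondA (a₁ α₁₁ α₁₂ : ℝ) (m : Measure (ℝ × ℝ)) : Prop :=
  ∃ θ > (0 : ℝ), (∀ z ≥ θ, 0 < phi0 a₁ α₁₁ α₁₂ m z) ∧
    ∫⁻ z in Set.Ici θ, ENNReal.ofReal (phi0 a₁ α₁₁ α₁₂ m z)⁻¹ < ⊤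

/-- The measure `n_ε` on `ℝ`. -/
def nEps (n : Measure (ℝ × ℝ)) (ε : ℝ) : Measure ℝ :=
  if n {z : ℝ × ℝ | 0 ≤ z.1} < ⊤ then
    Measure.map Prod.snd (n.restrict {z : ℝ × ℝ | 0 ≤ z.1})
  else
    Measure.map Prod.snd (n.restrict {z : ℝ × ℝ | 0 ≤ z.1 ∧ ε ≤ |z.2|})

/-- Condition (B), with the constants `ε, η` explicit. -/
def CondB (n : Measure (ℝ × ℝ)) (ε η : ℝ) : Prop :=
  0 < ε ∧ 0 < η ∧
  (∃ c : ℝ≥0∞, 0 < c ∧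
      ∀ a : ℝ, |a| ≤ η → c ≤ (nEps n ε ⊓ translate a (nEps n ε)) Set.univ) ∧
  ∫⁻ z in {z : ℝ × ℝ | ε < |z.2|}, ENNReal.ofReal |z.2| ∂n < ⊤

/-- `limsup_{ρ → 0} [ sup_{|a| ≤ ρ} ‖σ - δ_a * σ‖_var / ρ ] < ∞`. -/
def SmoothShift (σ : Measure ℝ) : Prop :=
  ∃ C > (0 : ℝ), ∃ δ > (0 : ℝ), ∀ ρ : ℝ, 0 < ρ → ρ ≤ δ →
    ∀ a : ℝ, |a| ≤ ρ → tvDist σ (translate a σ) ≤ C * ρ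

/-- Condition (C), with the constant `ε` explicit. -/
def CondC (n : Measure (ℝ × ℝ)) (ε : ℝ) : Prop :=
  0 < ε ∧ 0 < nEps n ε Set.univ ∧ SmoothShift (nEps n ε) ∧
  ∫⁻ z in {z : ℝ × ℝ | ε < |z.2|}, ENNReal.ofReal |z.2| ∂n < ⊤

/-- Condition (C'), with the constant `ε` explicit. -/
def CondC' (n : Measure (ℝ × ℝ)) (ε : ℝ) : Prop :=
  0 < ε ∧ 0 < nEps n ε Set.univ ∧ SmoothShift (nEps n ε) ∧
  ∫⁻ z in {z : ℝ × ℝ | 1 < |z.2|}, ENNReal.ofReal (z.2 ^ 2) ∂n < ⊤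

/-- The measure `σ₀ = ϱ₀(z₂) dz₂` of Condition (D). -/
def sigma0 (ϱ₀ : ℝ → ℝ) : Measure ℝ :=
  volume.withDensity fun x => ENNReal.ofReal (ϱ₀ x)

/-- The measure `σ_k = ((k g) ∧ ϱ₀)(z₂) dz₂` of Condition (D). -/
def sigmaK (ϱ₀ g : ℝ → ℝ) (k : ℕ) : Measure ℝ :=
  volume.withDensity fun x => ENNReal.ofReal (min ((k : ℝ) * g x) (ϱ₀ x))

/-- Condition (D), with `ϱ₀`, `g` and `K` explicit. -/
def CondD (n : Measure (ℝ × ℝ)) (ϱ₀ g : ℝ → ℝ) (K : ℕ) : Prop :=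
  Measurable ϱ₀ ∧ (∀ x, 0 ≤ ϱ₀ x) ∧
  (∀ B : Set ℝ, MeasurableSet B → sigma0 ϱ₀ B ≤ n {z : ℝ × ℝ | 0 ≤ z.1 ∧ z.2 ∈ B}) ∧
  0 < sigma0 ϱ₀ Set.univ ∧
  (∀ x, 0 < g x) ∧ Integrable g ∧ 1 ≤ K ∧
  ∀ k, K ≤ k → SmoothShift (sigmaK ϱ₀ g k) ∧
    ∫⁻ x, ENNReal.ofReal |x| ∂(sigmaK ϱ₀ g k) < ⊤

/-- The transition semigroup of a (1+1)-dimensional affine Markov process, together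
with all the standing assumptions of the paper. -/
structure AffineSemigroup where
  a₁ : ℝ
  a₂ : ℝ
  b₀ : ℝ
  b₁ : ℝ
  b₂ : ℝ
  σ : ℝ
  α₁₁ : ℝ
  α₁₂ : ℝ
  α₂₁ : ℝ
  α₂₂ : ℝ
  m : Measure (ℝ × ℝ)
  n : Measure (ℝ × ℝ)
  V₁ : ℝ → ℂ × ℂ → ℂ
  P : ℝ → ℝ × ℝ → Measure (ℝ × ℝ)
  a₂_nonneg : 0 ≤ a₂
  σ_nonneg : 0 ≤ σ
  α₁₁_nonneg : 0 ≤ α₁₁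
  α₁₂_nonneg : 0 ≤ α₁₂
  α₂₁_nonneg : 0 ≤ α₂₁
  α₂₂_nonneg : 0 ≤ α₂₂
  m_supp : m {z : ℝ × ℝ | z.1 < 0 ∨ z = 0} = 0
  n_supp : n {z : ℝ × ℝ | z.1 < 0 ∨ z = 0} = 0
  m_int : ∫⁻ z : ℝ × ℝ, ENNReal.ofReal (min z.1 (z.1 ^ 2) + z.2 ^ 2) ∂m < ⊤
  n_int : ∫⁻ z : ℝ × ℝ, ENNReal.ofReal (min 1 z.1 + min |z.2| (z.2 ^ 2)) ∂n < ⊤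
  V₁_init : ∀ u : ℂ × ℂ, V₁ 0 u = u.1
  V₁_mem : ∀ u : ℂ × ℂ, u.1.re ≤ 0 → u.2.re = 0 → ∀ t, 0 ≤ t → (V₁ t u).re ≤ 0
  V₁_ode : ∀ u : ℂ × ℂ, u.1.re ≤ 0 → u.2.re = 0 → ∀ t, 0 ≤ t →
    HasDerivAt (fun s => V₁ s u)
      (phi a₁ b₁ α₁₁ α₁₂ α₂₁ α₂₂ m
        (V₁ t u, Complex.exp (-(b₂ : ℂ) * (t : ℂ)) * u.2)) t
  P_prob : ∀ t, 0 ≤ t → ∀ x : ℝ × ℝ, 0 ≤ x.1 → IsProbabilityMeasure (P t x)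
  P_supp : ∀ t, 0 ≤ t → ∀ x : ℝ × ℝ, 0 ≤ x.1 → P t x {ξ : ℝ × ℝ | ξ.1 < 0} = 0
  P_meas : ∀ t, 0 ≤ t → Measurable (P t)
  P_zero : ∀ x : ℝ × ℝ, P 0 x = Measure.dirac x
  P_CK : ∀ t, 0 ≤ t → ∀ s, 0 ≤ s → ∀ x : ℝ × ℝ, P (t + s) x = (P t x).bind (P s)
  P_char : ∀ t, 0 ≤ t → ∀ x : ℝ × ℝ, 0 ≤ x.1 → ∀ u : ℂ × ℂ, u.1.re = 0 → u.2.re = 0 →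
    ∫ ξ : ℝ × ℝ, Complex.exp (u.1 * (ξ.1 : ℂ) + u.2 * (ξ.2 : ℂ)) ∂(P t x)
      = Complex.exp ((x.1 : ℂ) * V₁ t u
          + (x.2 : ℂ) * (Complex.exp (-(b₂ : ℂ) * (t : ℂ)) * u.2)
          + ∫ s in (0:ℝ)..t,
              psi a₂ b₀ σ n (V₁ s u, Complex.exp (-(b₂ : ℂ) * (s : ℂ)) * u.2))

/-- A stationary (invariant) distribution for the semigroup `P` on `G = ℝ₊ × ℝ`. -/
def IsStationary (P : ℝ → ℝ × ℝ → Measure (ℝ × ℝ)) (π : Measure (ℝ × ℝ)) : Prop :=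
  IsProbabilityMeasure π ∧ π {x : ℝ × ℝ | x.1 < 0} = 0 ∧ ∀ t, 0 ≤ t → π.bind (P t) = π

/-- Defining properties of the minimal solution `v̄` of `(d/dt) v̄_t = -φ₀(v̄_t)`,
`v̄_{0+} = ∞`. -/
def IsVbar (a₁ α₁₁ α₁₂ : ℝ) (m : Measure (ℝ × ℝ)) (v : ℝ → ℝ) : Prop :=
  (∀ t > (0 : ℝ), 0 < v t) ∧
  (∀ t > (0 : ℝ), HasDerivAt v (-(phi0 a₁ α₁₁ α₁₂ m (v t))) t) ∧
  Tendsto v (𝓝[>] (0 : ℝ)) atTop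

/-- The constant `C₁₁` of Lemma 3.1. -/
def C11 (S : AffineSemigroup) : ℝ :=
  (S.a₁ - 2 * S.b₂)⁻¹ * ∫ z : ℝ × ℝ, z.2 ^ 2 ∂S.m

/-- The constant `C₁₂` of Lemma 3.1. -/
def C12 (S : AffineSemigroup) : ℝ :=
  8 * max S.α₂₁ S.α₂₂ / (S.a₁ - 2 * S.b₂)

/-- The constant `C₁` of Lemma 3.1. -/
def C1 (S : AffineSemigroup) : ℝ := 4 * max (C11 S) (C12 S)

/-- The constant `C₂` of Lemma 3.1. -/
def C2 (S : AffineSemigroup) : ℝ := |S.b₁| / (S.a₁ - S.b₂)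

/-- The exponential `z ↦ e^{⟨u,z⟩}`. -/
def expPair (u : ℂ × ℂ) (z : ℝ × ℝ) : ℂ :=
  Complex.exp (u.1 * (z.1 : ℂ) + u.2 * (z.2 : ℂ))

lemma measurable_expPair (u : ℂ × ℂ) : Measurable (expPair u) := by
  unfold expPair; fun_prop

lemma expPair_add (u : ℂ × ℂ) (x y : ℝ × ℝ) : expPair u (x + y) = expPair u x * expPair u y := by
  simp only [expPair, ← Complex.exp_add, Prod.fst_add, Prod.snd_add]
  push_cast
  ring_nf

lemma re_pairing_nonpos {u : ℂ × ℂ} (h1 : u.1.re ≤ 0) (h2 : u.2.re = 0) {z : ℝ × ℝ}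
    (hz : 0 ≤ z.1) : (u.1 * (z.1 : ℂ) + u.2 * (z.2 : ℂ)).re ≤ 0 := by
  simp [h2, mul_nonpos_of_nonpos_of_nonneg h1 hz]

lemma norm_expPair_le {u : ℂ × ℂ} (h1 : u.1.re ≤ 0) (h2 : u.2.re = 0) {z : ℝ × ℝ}
    (hz : 0 ≤ z.1) : ‖expPair u z‖ ≤ 1 := by
  rw [expPair, Complex.norm_exp]
  exact Real.exp_le_one_iff.2 (re_pairing_nonpos h1 h2 hz)

lemma integrable_expPair {ρ : Measure (ℝ × ℝ)} [IsFiniteMeasure ρ] (hρ : ∀ᵐ z ∂ρ, 0 ≤ z.1)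
    {u : ℂ × ℂ} (h1 : u.1.re ≤ 0) (h2 : u.2.re = 0) : Integrable (expPair u) ρ := by
  refine Integrable.of_bound (measurable_expPair u).aestronglyMeasurable 1 ?_
  filter_upwards [hρ] with z hz using norm_expPair_le h1 h2 hz

lemma integral_add_add {α : Type*} [MeasurableSpace α] {μ : Measure α} {f g h : α → ℝ}
    (hf : Integrable f μ) (hg : Integrable g μ) (hh : Integrable h μ) :
    ∫ x, (f x + g x + h x) ∂μ = ∫ x, f x ∂μ + ∫ x, g x ∂μ + ∫ x, h x ∂μ := by
  rw [integral_add (f := fun x => f x + g x) (hf.add hg) hh, integral_add hf hg]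

/-- Convolution powers of a measure. -/
def convPow (ρ : Measure (ℝ × ℝ)) : ℕ → Measure (ℝ × ℝ)
  | 0 => Measure.dirac 0
  | n + 1 => (convPow ρ n).conv ρ

section ConvPow

variable {ρ : Measure (ℝ × ℝ)} [IsFiniteMeasure ρ]

instance isFiniteMeasure_convPow (n : ℕ) : IsFiniteMeasure (convPow ρ n) := by
  induction n with
  | zero => unfold convPow; infer_instance
  | succ n ih => unfold convPow; infer_instance

lemma ae_conv_nonneg {μ ν : Measure (ℝ × ℝ)} [SFinite μ] [SFinite ν] (hμ : ∀ᵐ z ∂μ, 0 ≤ z.1)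
    (hν : ∀ᵐ z ∂ν, 0 ≤ z.1) : ∀ᵐ z ∂(μ.conv ν), 0 ≤ z.1 := by
  rw [Measure.conv, ae_map_iff (by fun_prop)
    (measurableSet_le measurable_const measurable_fst)]
  filter_upwards [Measure.quasiMeasurePreserving_fst.ae hμ,
    Measure.quasiMeasurePreserving_snd.ae hν] with p h1 h2
  exact add_nonneg h1 h2

lemma ae_convPow_nonneg (hρ : ∀ᵐ z ∂ρ, 0 ≤ z.1) (n : ℕ) : ∀ᵐ z ∂(convPow ρ n), 0 ≤ z.1 := by
  induction n with
  | zero =>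
    unfold convPow
    rw [ae_dirac_iff (measurableSet_le measurable_const measurable_fst)]; simp
  | succ n ih => exact ae_conv_nonneg ih hρ

lemma integral_expPair_convPow (hρ : ∀ᵐ z ∂ρ, 0 ≤ z.1) {u : ℂ × ℂ} (h1 : u.1.re ≤ 0)
    (h2 : u.2.re = 0) (n : ℕ) : ∫ z, expPair u z ∂(convPow ρ n) = (∫ z, expPair u z ∂ρ) ^ n := by
  induction n with
  | zero => simp [convPow, expPair]
  | succ n ih =>
    have h := integrable_expPair (ae_convPow_nonneg hρ (n + 1)) h1 h2
    rw [convPow] at h ⊢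
    rw [integral_conv h]
    simp_rw [expPair_add, integral_const_mul, integral_mul_const, ih, pow_succ]

lemma measureReal_convPow_univ (n : ℕ) : (convPow ρ n).real univ = (ρ.real univ) ^ n := by
  induction n with
  | zero => simp [convPow]
  | succ n ih =>
    have : (convPow ρ (n + 1)) univ = convPow ρ n univ * ρ univ := by
      rw [convPow, Measure.conv, Measure.map_apply (by fun_prop) MeasurableSet.univ, preimage_univ,
        ← univ_prod_univ, Measure.prod_prod]
    rw [measureReal_def, this, ENNReal.toReal_mul, pow_succ, ← ih]; rfl

variable {f : ℝ × ℝ → ℝ} (hf : Measurable f) (hadd : ∀ x y, f (x + y) = f x + f y)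

include hf hadd

lemma integrable_conv_of_additive {μ ν : Measure (ℝ × ℝ)} [IsFiniteMeasure μ] [IsFiniteMeasure ν]
    (hμ : Integrable f μ) (hν : Integrable f ν) : Integrable f (μ.conv ν) := by
  rw [Measure.conv, integrable_map_measure hf.aestronglyMeasurable (by fun_prop)]
  have : f ∘ (fun p : (ℝ × ℝ) × (ℝ × ℝ) => p.1 + p.2) = fun p => f p.1 + f p.2 := by
    ext p; simp [hadd]
  rw [this]
  exact (hμ.comp_fst ν).add (hν.comp_snd μ)

lemma integral_conv_of_additive {μ ν : Measure (ℝ × ℝ)} [IsFiniteMeasure μ] [IsFiniteMeasure ν]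
    (hμ : Integrable f μ) (hν : Integrable f ν) :
    ∫ z, f z ∂(μ.conv ν) = (∫ z, f z ∂μ) * ν.real univ + μ.real univ * ∫ z, f z ∂ν := by
  rw [integral_conv (integrable_conv_of_additive hf hadd hμ hν)]
  have h : ∀ x, ∫ y, f (x + y) ∂ν = f x * ν.real univ + ∫ y, f y ∂ν := by
    intro x
    simp_rw [hadd]
    rw [integral_add (integrable_const _) hν, integral_const, smul_eq_mul, mul_comm]
  simp_rw [h]
  rw [integral_add (hμ.mul_const _) (integrable_const _), integral_mul_const, integral_const,
    smul_eq_mul]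

lemma integrable_sq_conv_of_additive {μ ν : Measure (ℝ × ℝ)} [IsFiniteMeasure μ]
    [IsFiniteMeasure ν] (hμ : Integrable f μ) (hν : Integrable f ν)
    (hμ2 : Integrable (fun z => f z ^ 2) μ) (hν2 : Integrable (fun z => f z ^ 2) ν) :
    Integrable (fun z => f z ^ 2) (μ.conv ν) := by
  rw [Measure.conv, integrable_map_measure (hf.pow_const 2).aestronglyMeasurable (by fun_prop)]
  have : (fun z => f z ^ 2) ∘ (fun p : (ℝ × ℝ) × (ℝ × ℝ) => p.1 + p.2)
      = fun p => f p.1 ^ 2 + 2 * (f p.1 * f p.2) + f p.2 ^ 2 := by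
    ext p; simp only [Function.comp, hadd]; ring
  rw [this]
  exact ((hμ2.comp_fst ν).add ((hμ.mul_prod hν).const_mul 2)).add (hν2.comp_snd μ)

lemma integral_sq_conv_of_additive {μ ν : Measure (ℝ × ℝ)} [IsFiniteMeasure μ]
    [IsFiniteMeasure ν] (hμ : Integrable f μ) (hν : Integrable f ν)
    (hμ2 : Integrable (fun z => f z ^ 2) μ) (hν2 : Integrable (fun z => f z ^ 2) ν) :
    ∫ z, f z ^ 2 ∂(μ.conv ν) = (∫ z, f z ^ 2 ∂μ) * ν.real univ
      + 2 * (∫ z, f z ∂μ) * (∫ z, f z ∂ν) + μ.real univ * ∫ z, f z ^ 2 ∂ν := by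
  rw [integral_conv (integrable_sq_conv_of_additive hf hadd hμ hν hμ2 hν2)]
  have h : ∀ x, ∫ y, f (x + y) ^ 2 ∂ν
      = f x ^ 2 * ν.real univ + f x * (2 * ∫ y, f y ∂ν) + ∫ y, f y ^ 2 ∂ν := by
    intro x
    have : ∀ y, f (x + y) ^ 2 = f x ^ 2 + f x * 2 * f y + f y ^ 2 := by
      intro y; rw [hadd]; ring
    simp_rw [this]
    rw [integral_add_add (integrable_const _) (hν.const_mul _) hν2, integral_const,
      integral_const_mul, smul_eq_mul]
    ring
  simp_rw [h]
  rw [integral_add_add (hμ2.mul_const _) (hμ.mul_const _) (integrable_const _),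
    integral_mul_const, integral_mul_const, integral_const, smul_eq_mul]
  ring

lemma integrable_convPow (hρ : Integrable f ρ) (n : ℕ) : Integrable f (convPow ρ n) := by
  induction n with
  | zero => unfold convPow; exact integrable_dirac (by simp)
  | succ n ih => exact integrable_conv_of_additive hf hadd ih hρ

lemma integrable_sq_convPow (hρ : Integrable f ρ) (hρ2 : Integrable (fun z => f z ^ 2) ρ) (n : ℕ) :
    Integrable (fun z => f z ^ 2) (convPow ρ n) := by
  induction n with
  | zero => unfold convPow; exact integrable_dirac (by simp)
  | succ n ih =>
    exact integrable_sq_conv_of_additive hf hadd (integrable_convPow hf hadd hρ n) hρ ih hρ2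

omit hf in
lemma map_zero_of_additive : f 0 = 0 := by
  have := hadd 0 0
  simpa using this

lemma integral_convPow_succ (hρ : Integrable f ρ) (n : ℕ) :
    ∫ z, f z ∂(convPow ρ (n + 1)) = (n + 1) * ρ.real univ ^ n * ∫ z, f z ∂ρ := by
  induction n with
  | zero =>
    rw [convPow, integral_conv_of_additive hf hadd (integrable_convPow hf hadd hρ 0) hρ,
      measureReal_convPow_univ]
    simp [convPow, map_zero_of_additive hadd]
  | succ n ih =>
    rw [convPow, integral_conv_of_additive hf hadd (integrable_convPow hf hadd hρ (n + 1)) hρ, ih,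
      measureReal_convPow_univ]
    push_cast
    ring

lemma integral_sq_convPow_add_two (hρ : Integrable f ρ) (hρ2 : Integrable (fun z => f z ^ 2) ρ)
    (n : ℕ) :
    ∫ z, f z ^ 2 ∂(convPow ρ (n + 2)) = (n + 2) * ρ.real univ ^ (n + 1) * ∫ z, f z ^ 2 ∂ρ
      + (n + 2) * (n + 1) * ρ.real univ ^ n * (∫ z, f z ∂ρ) ^ 2 := by
  have h1 : ∫ z, f z ^ 2 ∂(convPow ρ 1) = ∫ z, f z ^ 2 ∂ρ := by
    rw [convPow, integral_sq_conv_of_additive hf hadd (integrable_convPow hf hadd hρ 0) hρ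
      (integrable_sq_convPow hf hadd hρ hρ2 0) hρ2, measureReal_convPow_univ]
    simp [convPow, map_zero_of_additive hadd]
  induction n with
  | zero =>
    rw [convPow, integral_sq_conv_of_additive hf hadd (integrable_convPow hf hadd hρ 1) hρ
      (integrable_sq_convPow hf hadd hρ hρ2 1) hρ2, measureReal_convPow_univ, h1,
      integral_convPow_succ hf hadd hρ]
    push_cast
    ring
  | succ n ih =>
    rw [convPow, integral_sq_conv_of_additive hf hadd (integrable_convPow hf hadd hρ (n + 2)) hρ
      (integrable_sq_convPow hf hadd hρ hρ2 (n + 2)) hρ2, measureReal_convPow_univ, ih,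
      integral_convPow_succ hf hadd hρ]
    push_cast
    ring

end ConvPow

/-- The compound Poisson distribution with Lévy measure `r • ρ`. -/
def compoundPoisson (ρ : Measure (ℝ × ℝ)) (r : ℝ) : Measure (ℝ × ℝ) :=
  Measure.sum fun n : ℕ =>
    ENNReal.ofReal (Real.exp (-(r * ρ.real univ)) * r ^ n / n.factorial) • convPow ρ n

section CompoundPoisson

variable {ρ : Measure (ℝ × ℝ)} [IsFiniteMeasure ρ]

omit [IsFiniteMeasure ρ] in
lemma measurable_compoundPoisson : Measurable (compoundPoisson ρ) := by
  refine Measure.measurable_of_measurable_coe _ fun s hs => ?_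
  simp only [compoundPoisson, Measure.sum_apply _ hs, Measure.smul_apply, smul_eq_mul]
  refine Measurable.tsum fun n => ?_
  fun_prop

lemma ae_compoundPoisson_nonneg (hρ : ∀ᵐ z ∂ρ, 0 ≤ z.1) (r : ℝ) :
    ∀ᵐ z ∂(compoundPoisson ρ r), 0 ≤ z.1 := by
  rw [compoundPoisson, Measure.ae_sum_iff]
  intro n
  exact Measure.ae_smul_measure (ae_convPow_nonneg hρ n) _

lemma hasSum_poisson_weights (r : ℝ) (θ : ℝ) :
    HasSum (fun n : ℕ => Real.exp (-(r * θ)) * (r * θ) ^ n / n.factorial) 1 := by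
  convert! (NormedSpace.expSeries_div_hasSum_exp (r * θ)).mul_left (Real.exp (-(r * θ))) using 1
  · simp_rw [mul_div_assoc]
  · simp [← Real.exp_eq_exp_ℝ, ← Real.exp_add]

omit [IsFiniteMeasure ρ] in
lemma integral_smul_weight {E : Type*} [NormedAddCommGroup E] [NormedSpace ℝ E] {r : ℝ}
    (hr : 0 ≤ r) (g : ℝ × ℝ → E) (n : ℕ) :
    ∫ z, g z ∂(ENNReal.ofReal (Real.exp (-(r * ρ.real univ)) * r ^ n / n.factorial) • convPow ρ n)
      = (Real.exp (-(r * ρ.real univ)) * r ^ n / n.factorial) • ∫ z, g z ∂(convPow ρ n) := by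
  rw [integral_smul_measure, ENNReal.toReal_ofReal (by positivity)]

lemma isProbabilityMeasure_compoundPoisson {r : ℝ} (hr : 0 ≤ r) :
    IsProbabilityMeasure (compoundPoisson ρ r) := by
  constructor
  rw [compoundPoisson, Measure.sum_apply _ MeasurableSet.univ]
  have h : ∀ n : ℕ, (ENNReal.ofReal (Real.exp (-(r * ρ.real univ)) * r ^ n / n.factorial)
      • convPow ρ n) univ
      = ENNReal.ofReal (Real.exp (-(r * ρ.real univ)) * (r * ρ.real univ) ^ n / n.factorial) := by
    intro n
    rw [Measure.smul_apply, smul_eq_mul, ← ofReal_measureReal, measureReal_convPow_univ,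
      ← ENNReal.ofReal_mul (by positivity)]
    congr 1
    ring
  simp_rw [h]
  have hs := hasSum_poisson_weights r (ρ.real univ)
  rw [← ENNReal.ofReal_tsum_of_nonneg (fun n => by positivity) hs.summable, hs.tsum_eq,
    ENNReal.ofReal_one]

lemma integral_expPair_compoundPoisson (hρ : ∀ᵐ z ∂ρ, 0 ≤ z.1) {u : ℂ × ℂ} (h1 : u.1.re ≤ 0)
    (h2 : u.2.re = 0) {r : ℝ} (hr : 0 ≤ r) :
    ∫ z, expPair u z ∂(compoundPoisson ρ r)
      = Complex.exp (r * ∫ z, (expPair u z - 1) ∂ρ) := by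
  have := isProbabilityMeasure_compoundPoisson (ρ := ρ) hr
  have hi := integrable_expPair (ae_compoundPoisson_nonneg hρ r) h1 h2
  have hs := hasSum_integral_measure hi
  simp_rw [integral_smul_weight hr, integral_expPair_convPow hρ h1 h2] at hs
  refine hs.unique ?_
  have hexp := (NormedSpace.expSeries_div_hasSum_exp (𝔸 := ℂ)
    (r * ∫ z, expPair u z ∂ρ)).mul_left ((Real.exp (-(r * ρ.real univ)) : ℝ) : ℂ)
  convert! hexp using 1
  · ext n
    simp only [Complex.real_smul]
    push_cast
    ring
  · rw [← Complex.exp_eq_exp_ℂ, integral_sub (integrable_expPair hρ h1 h2) (integrable_const _),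
      integral_const]
    push_cast
    rw [← Complex.exp_add]
    congr 1
    simp
    ring

variable {f : ℝ × ℝ → ℝ} (hf : Measurable f) (hadd : ∀ x y, f (x + y) = f x + f y)
  (hρ : Integrable f ρ) (hρ2 : Integrable (fun z => f z ^ 2) ρ)

include hf hadd hρ hρ2

lemma hasSum_sq_compoundPoisson (r : ℝ) :
    HasSum (fun n : ℕ => (Real.exp (-(r * ρ.real univ)) * r ^ n / n.factorial)
        • ∫ z, f z ^ 2 ∂(convPow ρ n))
      (r * ∫ z, f z ^ 2 ∂ρ + (r * ∫ z, f z ∂ρ) ^ 2) := by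
  set θ := ρ.real univ
  have hs := hasSum_poisson_weights r θ
  have hs1 := (hasSum_nat_add_iff' 1).2 hs
  rw [← hasSum_nat_add_iff' 2]
  convert! (hs1.mul_left (r * ∫ z, f z ^ 2 ∂ρ)).add (hs.mul_left ((r * ∫ z, f z ∂ρ) ^ 2)) using 1
  · ext n
    rw [integral_sq_convPow_add_two hf hadd hρ hρ2]
    simp only [Nat.factorial_succ]
    have hn := Nat.factorial_pos n
    push_cast
    have h1 : (n.factorial : ℝ) ≠ 0 := by exact_mod_cast hn.ne'
    have h2 : (n : ℝ) + 1 ≠ 0 := by positivity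
    have h3 : (n : ℝ) + 1 + 1 ≠ 0 := by positivity
    rw [smul_eq_mul]
    field_simp
    ring
  · have h1 : ∫ z, f z ^ 2 ∂(convPow ρ 1) = ∫ z, f z ^ 2 ∂ρ := by
      rw [convPow, integral_sq_conv_of_additive hf hadd (integrable_convPow hf hadd hρ 0) hρ
        (integrable_sq_convPow hf hadd hρ hρ2 0) hρ2, measureReal_convPow_univ]
      simp [convPow, map_zero_of_additive hadd]
    have h0 : ∫ z, f z ^ 2 ∂(convPow ρ 0) = 0 := by
      simp [convPow, map_zero_of_additive hadd]
    simp only [Finset.sum_range_succ, Finset.sum_range_zero, h0, h1, smul_eq_mul]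
    simp
    ring

lemma integrable_sq_compoundPoisson {r : ℝ} (hr : 0 ≤ r) :
    Integrable (fun z => f z ^ 2) (compoundPoisson ρ r) := by
  refine integrable_sum_measure (fun n => ?_) ?_
  · exact (integrable_sq_convPow hf hadd hρ hρ2 n).smul_measure ENNReal.ofReal_ne_top
  · have := (hasSum_sq_compoundPoisson hf hadd hρ hρ2 r).summable
    simpa only [Real.norm_eq_abs, abs_pow, sq_abs, integral_smul_weight hr] using this

lemma integral_sq_compoundPoisson {r : ℝ} (hr : 0 ≤ r) :
    ∫ z, f z ^ 2 ∂(compoundPoisson ρ r) = r * ∫ z, f z ^ 2 ∂ρ + (r * ∫ z, f z ∂ρ) ^ 2 := by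
  have hs := hasSum_integral_measure (integrable_sq_compoundPoisson hf hadd hρ hρ2 hr)
  simp_rw [integral_smul_weight hr] at hs
  exact hs.unique (hasSum_sq_compoundPoisson hf hadd hρ hρ2 r)

lemma integrable_compoundPoisson {r : ℝ} (hr : 0 ≤ r) :
    Integrable f (compoundPoisson ρ r) := by
  have := isProbabilityMeasure_compoundPoisson (ρ := ρ) hr
  refine Integrable.mono' ((integrable_const (1 : ℝ)).add
    (integrable_sq_compoundPoisson hf hadd hρ hρ2 hr)) hf.aestronglyMeasurable
    (Eventually.of_forall fun z => ?_)
  simp only [Pi.add_apply, Real.norm_eq_abs]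
  nlinarith [sq_abs (f z), sq_nonneg (|f z| - 1), abs_nonneg (f z)]

lemma integral_compoundPoisson {r : ℝ} (hr : 0 ≤ r) :
    ∫ z, f z ∂(compoundPoisson ρ r) = r * ∫ z, f z ∂ρ := by
  have hs := hasSum_integral_measure (integrable_compoundPoisson hf hadd hρ hρ2 hr)
  simp_rw [integral_smul_weight hr] at hs
  refine hs.unique ?_
  rw [← hasSum_nat_add_iff' 1]
  convert! (hasSum_poisson_weights r (ρ.real univ)).mul_left (r * ∫ z, f z ∂ρ) using 1
  · ext n
    rw [integral_convPow_succ hf hadd hρ]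
    simp only [Nat.factorial_succ]
    have h1 : (n.factorial : ℝ) ≠ 0 := by exact_mod_cast (Nat.factorial_pos n).ne'
    have h2 : (n : ℝ) + 1 ≠ 0 := by positivity
    push_cast
    rw [smul_eq_mul]
    field_simp
    ring
  · simp [convPow, map_zero_of_additive hadd]

lemma integral_sq_compensated_compoundPoisson {r : ℝ} (hr : 0 ≤ r) (c : ℝ) :
    ∫ z, (c + (f z - r * ∫ z, f z ∂ρ)) ^ 2 ∂(compoundPoisson ρ r)
      = c ^ 2 + r * ∫ z, f z ^ 2 ∂ρ := by
  have := isProbabilityMeasure_compoundPoisson (ρ := ρ) hr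
  set e := r * ∫ z, f z ∂ρ with he
  have h : ∀ z, (c + (f z - e)) ^ 2 = (c - e) ^ 2 + 2 * (c - e) * f z + f z ^ 2 := by
    intro z; ring
  simp_rw [h]
  rw [integral_add_add (integrable_const _)
    ((integrable_compoundPoisson hf hadd hρ hρ2 hr).const_mul _)
    (integrable_sq_compoundPoisson hf hadd hρ hρ2 hr), integral_const, integral_const_mul,
    integral_compoundPoisson hf hadd hρ hρ2 hr, integral_sq_compoundPoisson hf hadd hρ hρ2 hr,
    ← he]
  simp
  ring

lemma integrable_sq_compensated_compoundPoisson {r : ℝ} (hr : 0 ≤ r) (c e : ℝ) :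
    Integrable (fun z => (c + (f z - e)) ^ 2) (compoundPoisson ρ r) := by
  have := isProbabilityMeasure_compoundPoisson (ρ := ρ) hr
  have h : (fun z => (c + (f z - e)) ^ 2)
      = fun z => (c - e) ^ 2 + 2 * (c - e) * f z + f z ^ 2 := by
    ext z; ring
  rw [h]
  exact ((integrable_const _).add
    ((integrable_compoundPoisson hf hadd hρ hρ2 hr).const_mul _)).add
    (integrable_sq_compoundPoisson hf hadd hρ hρ2 hr)

end CompoundPoisson

/-- The branching exponent with drift `a₁, b₁` and Lévy measure `ρ`. -/
def levyExponent (a₁ b₁ : ℝ) (ρ : Measure (ℝ × ℝ)) (u : ℂ × ℂ) : ℂ :=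
  -(a₁ : ℂ) * u.1 - (b₁ : ℂ) * u.2
    + ∫ z : ℝ × ℝ, (expPair u z - 1 - (u.1 * (z.1 : ℂ) + u.2 * (z.2 : ℂ))) ∂ρ

/-- One step of the Euler scheme for the Riccati equation. -/
def eulerStep (a₁ b₁ b₂ : ℝ) (ρ : Measure (ℝ × ℝ)) (s : ℝ) (u : ℂ × ℂ) : ℂ × ℂ :=
  (u.1 + s * levyExponent a₁ b₁ ρ u, (Real.exp (-b₂ * s) : ℝ) * u.2)

section Chain

variable {ρ : Measure (ℝ × ℝ)} [IsFiniteMeasure ρ]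

lemma levyExponent_eq (hρ : ∀ᵐ z ∂ρ, 0 ≤ z.1) (hi1 : Integrable Prod.fst ρ)
    (hi2 : Integrable Prod.snd ρ) (a₁ b₁ : ℝ) {u : ℂ × ℂ} (h1 : u.1.re ≤ 0) (h2 : u.2.re = 0) :
    levyExponent a₁ b₁ ρ u = -((a₁ + ∫ z, z.1 ∂ρ : ℝ) : ℂ) * u.1
      - ((b₁ + ∫ z, z.2 ∂ρ : ℝ) : ℂ) * u.2 + ∫ z, (expPair u z - 1) ∂ρ := by
  have hE : Integrable (fun z => expPair u z - 1) ρ :=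
    (integrable_expPair hρ h1 h2).sub (integrable_const _)
  have hf : Integrable (fun z : ℝ × ℝ => u.1 * (z.1 : ℂ)) ρ := hi1.ofReal.const_mul _
  have hg : Integrable (fun z : ℝ × ℝ => u.2 * (z.2 : ℂ)) ρ := hi2.ofReal.const_mul _
  rw [levyExponent, integral_sub (g := fun z : ℝ × ℝ => u.1 * (z.1 : ℂ) + u.2 * (z.2 : ℂ)) hE
    (hf.add hg), integral_add hf hg, integral_const_mul,
    integral_const_mul, integral_complex_ofReal, integral_complex_ofReal]
  push_cast
  ring

lemma eulerStep_mem (hρ : ∀ᵐ z ∂ρ, 0 ≤ z.1) (hi1 : Integrable Prod.fst ρ)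
    (hi2 : Integrable Prod.snd ρ) {a₁ b₁ b₂ s : ℝ} (hs : 0 ≤ s)
    (hsA : s * (a₁ + ∫ z, z.1 ∂ρ) ≤ 1) {u : ℂ × ℂ} (h1 : u.1.re ≤ 0) (h2 : u.2.re = 0) :
    (eulerStep a₁ b₁ b₂ ρ s u).1.re ≤ 0 ∧ (eulerStep a₁ b₁ b₂ ρ s u).2.re = 0 := by
  refine ⟨?_, ?_⟩
  · have hE : Integrable (fun z => expPair u z - 1) ρ :=
      (integrable_expPair hρ h1 h2).sub (integrable_const _)
    have hI : (∫ z, (expPair u z - 1) ∂ρ).re ≤ 0 := by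
      have h := integral_re hE
      simp only [RCLike.re_eq_complex_re] at h
      rw [← h]
      refine integral_nonpos_of_ae ?_
      filter_upwards [hρ] with z hz
      have := (Complex.re_le_norm (expPair u z)).trans (norm_expPair_le h1 h2 hz)
      simpa using this
    simp only [eulerStep, levyExponent_eq hρ hi1 hi2 a₁ b₁ h1 h2]
    simp only [Complex.add_re, Complex.re_ofReal_mul, Complex.sub_re, neg_mul, Complex.neg_re, h2]
    nlinarith [mul_nonneg hs (neg_nonneg.2 hI)]
  · simp [eulerStep, h2, -Complex.ofReal_exp]

lemma lintegral_ofReal_eq {α : Type*} [MeasurableSpace α] {μ : Measure α} {f : α → ℝ}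
    (hf : Integrable f μ) (h : ∀ᵐ x ∂μ, 0 ≤ f x) {c : ℝ} (hc : ∫ x, f x ∂μ = c) :
    ∫⁻ x, ENNReal.ofReal (f x) ∂μ = ENNReal.ofReal c := by
  rw [← hc, ofReal_integral_eq_lintegral_ofReal hf h]

/-- The jump kernel of the Euler scheme. -/
def jumpKernel (ρ : Measure (ℝ × ℝ)) (s : ℝ) : ProbabilityTheory.Kernel (ℝ × ℝ × ℝ) (ℝ × ℝ) where
  toFun x := compoundPoisson ρ (s * max x.1 0)
  measurable' := measurable_compoundPoisson.comp (by fun_prop)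

lemma isMarkovKernel_jumpKernel {s : ℝ} (hs : 0 ≤ s) :
    ProbabilityTheory.IsMarkovKernel (jumpKernel ρ s) :=
  ⟨fun x => isProbabilityMeasure_compoundPoisson (mul_nonneg hs (le_max_right x.1 0))⟩

omit [IsFiniteMeasure ρ] in
lemma jumpKernel_apply {s : ℝ} {x : ℝ × ℝ × ℝ} (hx : 0 ≤ x.1) :
    jumpKernel ρ s x = compoundPoisson ρ (s * x.1) := by
  change compoundPoisson ρ (s * max x.1 0) = _
  rw [max_eq_left hx]

/-- The update map of the Euler scheme: `e` is the discount factor of the second coordinate. -/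
def chainMap (ρ : Measure (ℝ × ℝ)) (a₁ b₁ e s : ℝ) (p : (ℝ × ℝ × ℝ) × (ℝ × ℝ)) : ℝ × ℝ × ℝ :=
  ((1 - s * (a₁ + ∫ z, z.1 ∂ρ)) * p.1.1 + p.2.1, e * p.1.2.1 - s * b₁ * p.1.1,
    e * p.1.2.2 + (p.2.2 - s * p.1.1 * ∫ z, z.2 ∂ρ))

omit [IsFiniteMeasure ρ] in
lemma measurable_chainMap (a₁ b₁ e s : ℝ) : Measurable (chainMap ρ a₁ b₁ e s) := by
  unfold chainMap
  fun_prop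

lemma exists_chain (hρ : ∀ᵐ z ∂ρ, 0 ≤ z.1) (hi1 : Integrable Prod.fst ρ)
    (hi2 : Integrable Prod.snd ρ) (hq1 : Integrable (fun z => z.1 ^ 2) ρ)
    (hq2 : Integrable (fun z => z.2 ^ 2) ρ) {a₁ b₁ b₂ s h : ℝ} (hs : 0 ≤ s) (hh : 0 ≤ h)
    (hsA : s * (a₁ + ∫ z, z.1 ∂ρ) ≤ 1) (hb : 0 < 2 * b₂) (hba : 2 * b₂ < a₁) (k : ℕ) :
    ∃ ν : Measure (ℝ × ℝ × ℝ), IsProbabilityMeasure ν ∧ (∀ᵐ x ∂ν, 0 ≤ x.1) ∧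
      (∀ u : ℂ × ℂ, u.1.re ≤ 0 → u.2.re = 0 →
        ∫ x, expPair u (x.1, x.2.1 + x.2.2) ∂ν
          = Complex.exp (h * ((eulerStep a₁ b₁ b₂ ρ s)^[k] u).1)) ∧
      ∫⁻ x, ENNReal.ofReal x.1 ∂ν ≤ ENNReal.ofReal (h * (1 - s * a₁) ^ k) ∧
      ∫⁻ x, ENNReal.ofReal |x.2.1| ∂ν ≤ ENNReal.ofReal
        (h * |b₁| / (a₁ - b₂) * (Real.exp (-b₂ * s) ^ k - (1 - s * a₁) ^ k)) ∧
      ∫⁻ x, ENNReal.ofReal (x.2.2 ^ 2) ∂ν ≤ ENNReal.ofReal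
        (h * (∫ z, z.2 ^ 2 ∂ρ) / (a₁ - 2 * b₂)
          * ((Real.exp (-b₂ * s) ^ 2) ^ k - (1 - s * a₁) ^ k)) := by
  induction k with
  | zero =>
    refine ⟨Measure.dirac (h, 0, 0), inferInstance, ?_, ?_, ?_, ?_, ?_⟩
    · rw [ae_dirac_iff (measurableSet_le measurable_const measurable_fst)]; exact hh
    · intro u _ _
      simp [expPair, mul_comm]
    all_goals rw [lintegral_dirac' _ (by fun_prop)]; simp
  | succ k ih =>
    obtain ⟨ν, hν, hpos, hchar, hx1, hx2, hx3⟩ := ih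
    have := isMarkovKernel_jumpKernel (ρ := ρ) hs
    set q := 1 - s * a₁ with hq
    set e := Real.exp (-b₂ * s) with he
    set M1 := ∫ z, z.1 ∂ρ with hM1
    set M2 := ∫ z, z.2 ∂ρ with hM2
    set m2 := ∫ z, z.2 ^ 2 ∂ρ with hm2
    have he0 : 0 < e := Real.exp_pos _
    have hM10 : 0 ≤ M1 := integral_nonneg_of_ae hρ
    have hm20 : 0 ≤ m2 := integral_nonneg fun z => sq_nonneg _
    have hq0 : 0 ≤ q := by nlinarith
    have heq : (a₁ - b₂) * s ≤ e - q := by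
      have := Real.add_one_le_exp (-b₂ * s); linarith
    have heq2 : (a₁ - 2 * b₂) * s ≤ e ^ 2 - q := by
      have := Real.add_one_le_exp (2 * (-b₂ * s))
      rw [two_mul, Real.exp_add] at this
      nlinarith
    have hadd1 : ∀ x y : ℝ × ℝ, (x + y).1 = x.1 + y.1 := fun _ _ => rfl
    have hadd2 : ∀ x y : ℝ × ℝ, (x + y).2 = x.2 + y.2 := fun _ _ => rfl
    have hg := measurable_chainMap (ρ := ρ) a₁ b₁ e s
    have hL : ∀ f : ℝ × ℝ × ℝ → ℝ≥0∞, Measurable f →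
        ∫⁻ x, f x ∂((ν.compProd (jumpKernel ρ s)).map (chainMap ρ a₁ b₁ e s))
          = ∫⁻ x, ∫⁻ y, f (chainMap ρ a₁ b₁ e s (x, y)) ∂(jumpKernel ρ s x) ∂ν := by
      intro f hf
      rw [lintegral_map hf hg]
      exact Measure.lintegral_compProd (hf.comp hg)
    have hposnew : ∀ᵐ x ∂((ν.compProd (jumpKernel ρ s)).map (chainMap ρ a₁ b₁ e s)), 0 ≤ x.1 := by
      have hms : MeasurableSet {x : ℝ × ℝ × ℝ | 0 ≤ x.1} :=
        measurableSet_le measurable_const measurable_fst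
      rw [ae_map_iff hg.aemeasurable hms]
      refine Measure.ae_compProd_of_ae_ae (hg hms) ?_
      filter_upwards [hpos] with x hx
      rw [jumpKernel_apply hx]
      filter_upwards [ae_compoundPoisson_nonneg hρ (s * x.1)] with y hy
      exact add_nonneg (mul_nonneg (by linarith) hx) hy
    refine ⟨(ν.compProd (jumpKernel ρ s)).map (chainMap ρ a₁ b₁ e s),
      Measure.isProbabilityMeasure_map hg.aemeasurable, hposnew, ?_, ?_, ?_, ?_⟩
    · intro u h1 h2
      rw [Function.iterate_succ_apply]
      obtain ⟨h1', h2'⟩ := eulerStep_mem (b₁ := b₁) (b₂ := b₂) hρ hi1 hi2 hs hsA h1 h2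
      rw [← hchar _ h1' h2']
      have hmeas : Measurable fun x : ℝ × ℝ × ℝ => expPair u (x.1, x.2.1 + x.2.2) :=
        (measurable_expPair u).comp (by fun_prop)
      have hInt : Integrable (fun x : ℝ × ℝ × ℝ => expPair u (x.1, x.2.1 + x.2.2))
          ((ν.compProd (jumpKernel ρ s)).map (chainMap ρ a₁ b₁ e s)) := by
        have := Measure.isProbabilityMeasure_map (μ := ν.compProd (jumpKernel ρ s)) hg.aemeasurable
        refine Integrable.of_bound hmeas.aestronglyMeasurable 1 ?_
        filter_upwards [hposnew] with x hx using norm_expPair_le h1 h2 hx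
      rw [integral_map hg.aemeasurable hmeas.aestronglyMeasurable]
      refine (Measure.integral_compProd ((integrable_map_measure hmeas.aestronglyMeasurable
          hg.aemeasurable).1 hInt)).trans ?_
      refine integral_congr_ae ?_
      filter_upwards [hpos] with x hx
      have hfac : ∀ y : ℝ × ℝ, expPair u ((chainMap ρ a₁ b₁ e s (x, y)).1,
          (chainMap ρ a₁ b₁ e s (x, y)).2.1 + (chainMap ρ a₁ b₁ e s (x, y)).2.2)
          = Complex.exp (u.1 * ((1 - s * (a₁ + M1)) * x.1)
            + u.2 * (e * (x.2.1 + x.2.2) - s * x.1 * (b₁ + M2))) * expPair u y := by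
        intro y
        rw [expPair, expPair, ← Complex.exp_add]
        congr 1
        simp only [chainMap, ← hM1, ← hM2]
        push_cast
        ring
      simp_rw [Function.comp_def, hfac, integral_const_mul, jumpKernel_apply hx]
      rw [integral_expPair_compoundPoisson hρ h1 h2 (mul_nonneg hs hx), ← Complex.exp_add, expPair]
      congr 1
      simp only [eulerStep, levyExponent_eq hρ hi1 hi2 a₁ b₁ h1 h2, ← hM1, ← hM2, ← he]
      push_cast
      ring
    · rw [hL _ (by fun_prop)]
      calc _ = ∫⁻ x, ENNReal.ofReal q * ENNReal.ofReal x.1 ∂ν := by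
            refine lintegral_congr_ae ?_
            filter_upwards [hpos] with x hx
            have hr := mul_nonneg hs hx
            have := isProbabilityMeasure_compoundPoisson (ρ := ρ) hr
            rw [← ENNReal.ofReal_mul hq0, jumpKernel_apply hx]
            have hi := integrable_compoundPoisson measurable_fst hadd1 hi1 hq1 hr
            refine lintegral_ofReal_eq
              ((integrable_const ((1 - s * (a₁ + ∫ z, z.1 ∂ρ)) * x.1)).add hi) ?_ ?_
            · filter_upwards [ae_compoundPoisson_nonneg hρ (s * x.1)] with y hy
              exact add_nonneg (mul_nonneg (by linarith) hx) hy
            · change ∫ y : ℝ × ℝ, ((1 - s * (a₁ + ∫ z, z.1 ∂ρ)) * x.1 + y.1) ∂_ = _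
              rw [integral_add (integrable_const _) hi,
                integral_compoundPoisson measurable_fst hadd1 hi1 hq1 hr]
              simp [hq]
              ring
        _ = ENNReal.ofReal q * ∫⁻ x, ENNReal.ofReal x.1 ∂ν := lintegral_const_mul _ (by fun_prop)
        _ ≤ ENNReal.ofReal q * ENNReal.ofReal (h * q ^ k) := by gcongr
        _ = _ := by rw [← ENNReal.ofReal_mul hq0]; congr 1; ring
    · rw [hL _ (by fun_prop)]
      have hab : 0 < a₁ - b₂ := by linarith
      have hD : h * |b₁| / (a₁ - b₂) * (a₁ - b₂) = h * |b₁| := by field_simp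
      have hD0 : 0 ≤ h * |b₁| / (a₁ - b₂) := by positivity
      set D := h * |b₁| / (a₁ - b₂)
      have hqe : q ^ k ≤ e ^ k := by
        refine pow_le_pow_left₀ hq0 ?_ k
        nlinarith [mul_nonneg hab.le hs]
      calc _ ≤ ∫⁻ x, (ENNReal.ofReal e * ENNReal.ofReal |x.2.1|
              + ENNReal.ofReal (s * |b₁|) * ENNReal.ofReal x.1) ∂ν := by
            refine lintegral_mono_ae ?_
            filter_upwards [hpos] with x hx
            simp only [chainMap, lintegral_const, measure_univ, mul_one]
            rw [← ENNReal.ofReal_mul he0.le, ← ENNReal.ofReal_mul (by positivity),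
              ← ENNReal.ofReal_add (by positivity) (by positivity)]
            refine ENNReal.ofReal_le_ofReal ((abs_sub _ _).trans_eq ?_)
            rw [abs_mul, abs_mul, abs_mul, abs_of_pos he0, abs_of_nonneg hs, abs_of_nonneg hx]
        _ = ENNReal.ofReal e * ∫⁻ x, ENNReal.ofReal |x.2.1| ∂ν
              + ENNReal.ofReal (s * |b₁|) * ∫⁻ x, ENNReal.ofReal x.1 ∂ν := by
            rw [lintegral_add_left (by fun_prop), lintegral_const_mul _ (by fun_prop),
              lintegral_const_mul _ (by fun_prop)]
        _ ≤ ENNReal.ofReal e * ENNReal.ofReal (D * (e ^ k - q ^ k))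
              + ENNReal.ofReal (s * |b₁|) * ENNReal.ofReal (h * q ^ k) := by gcongr
        _ ≤ _ := by
            rw [← ENNReal.ofReal_mul he0.le, ← ENNReal.ofReal_mul (by positivity),
              ← ENNReal.ofReal_add
                (mul_nonneg he0.le (mul_nonneg hD0 (sub_nonneg.2 hqe))) (by positivity)]
            refine ENNReal.ofReal_le_ofReal ?_
            have h1 : D * ((a₁ - b₂) * s) * q ^ k ≤ D * (e - q) * q ^ k := by gcongr
            have h2 : D * ((a₁ - b₂) * s) * q ^ k = s * |b₁| * (h * q ^ k) := by
              rw [← mul_assoc D, hD]; ring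
            rw [h2] at h1
            linear_combination h1
    · rw [hL _ (by fun_prop)]
      have hab : 0 < a₁ - 2 * b₂ := by linarith
      have hD : h * m2 / (a₁ - 2 * b₂) * (a₁ - 2 * b₂) = h * m2 := by field_simp
      have hD0 : 0 ≤ h * m2 / (a₁ - 2 * b₂) := by positivity
      set D := h * m2 / (a₁ - 2 * b₂)
      have hqe : q ^ k ≤ (e ^ 2) ^ k := by
        refine pow_le_pow_left₀ hq0 ?_ k
        nlinarith [mul_nonneg hab.le hs]
      calc _ = ∫⁻ x, (ENNReal.ofReal (e ^ 2) * ENNReal.ofReal (x.2.2 ^ 2)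
              + ENNReal.ofReal (s * m2) * ENNReal.ofReal x.1) ∂ν := by
            refine lintegral_congr_ae ?_
            filter_upwards [hpos] with x hx
            have hr := mul_nonneg hs hx
            rw [← ENNReal.ofReal_mul (by positivity), ← ENNReal.ofReal_mul (by positivity),
              ← ENNReal.ofReal_add (by positivity) (by positivity), jumpKernel_apply hx]
            have hc : ∀ y, (chainMap ρ a₁ b₁ e s (x, y)).2.2
                = e * x.2.2 + (y.2 - s * x.1 * M2) := fun y => rfl
            simp_rw [hc]
            refine lintegral_ofReal_eq
              (integrable_sq_compensated_compoundPoisson measurable_snd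
              hadd2 hi2 hq2 hr (e * x.2.2) (s * x.1 * M2))
              (Eventually.of_forall fun y => sq_nonneg _) ?_
            rw [integral_sq_compensated_compoundPoisson measurable_snd
              hadd2 hi2 hq2 hr (e * x.2.2), ← hm2]
            ring
        _ = ENNReal.ofReal (e ^ 2) * ∫⁻ x, ENNReal.ofReal (x.2.2 ^ 2) ∂ν
              + ENNReal.ofReal (s * m2) * ∫⁻ x, ENNReal.ofReal x.1 ∂ν := by
            rw [lintegral_add_left (by fun_prop), lintegral_const_mul _ (by fun_prop),
              lintegral_const_mul _ (by fun_prop)]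
        _ ≤ ENNReal.ofReal (e ^ 2) * ENNReal.ofReal (D * ((e ^ 2) ^ k - q ^ k))
              + ENNReal.ofReal (s * m2) * ENNReal.ofReal (h * q ^ k) := by gcongr
        _ ≤ _ := by
            rw [← ENNReal.ofReal_mul (by positivity), ← ENNReal.ofReal_mul (by positivity),
              ← ENNReal.ofReal_add
                (mul_nonneg (by positivity) (mul_nonneg hD0 (sub_nonneg.2 hqe))) (by positivity)]
            refine ENNReal.ofReal_le_ofReal ?_
            have h1 : D * ((a₁ - 2 * b₂) * s) * q ^ k ≤ D * (e ^ 2 - q) * q ^ k := by gcongr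
            have h2 : D * ((a₁ - 2 * b₂) * s) * q ^ k = s * m2 * (h * q ^ k) := by
              rw [← mul_assoc D, hD]; ring
            rw [h2] at h1
            linear_combination h1

end Chain

section ComplexExp

lemma convex_leftHalfBall (r : ℝ) : Convex ℝ ({w : ℂ | w.re ≤ 0} ∩ Metric.closedBall 0 r) :=
  (convex_halfSpace_re_le 0).inter (convex_closedBall 0 r)

lemma norm_exp_sub_one_le {w : ℂ} (hw : w.re ≤ 0) : ‖Complex.exp w - 1‖ ≤ ‖w‖ := by
  have h := (convex_halfSpace_re_le 0).norm_image_sub_le_of_norm_hasDerivWithin_le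
    (f := Complex.exp) (f' := Complex.exp) (C := 1) (x := 0) (y := w)
    (fun x _ => (Complex.hasDerivAt_exp x).hasDerivWithinAt)
    (fun x hx => by rw [Complex.norm_exp]; exact Real.exp_le_one_iff.2 hx) (by simp) hw
  simpa using h

lemma norm_exp_sub_one_le_two {w : ℂ} (hw : w.re ≤ 0) : ‖Complex.exp w - 1‖ ≤ 2 := by
  refine (norm_sub_le _ _).trans ?_
  rw [Complex.norm_exp, norm_one]
  linarith [Real.exp_le_one_iff.2 hw]

/-- The second order remainder of the exponential. -/
def expRem (w : ℂ) : ℂ := Complex.exp w - 1 - w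

lemma hasDerivAt_expRem (w : ℂ) : HasDerivAt expRem (Complex.exp w - 1) w :=
  ((Complex.hasDerivAt_exp w).sub_const 1).sub (hasDerivAt_id w)

lemma norm_expRem_sub_le {w w' : ℂ} {r : ℝ} (hw : w.re ≤ 0) (hw' : w'.re ≤ 0) (hr : ‖w‖ ≤ r)
    (hr' : ‖w'‖ ≤ r) : ‖expRem w - expRem w'‖ ≤ min 2 r * ‖w - w'‖ := by
  refine (convex_leftHalfBall r).norm_image_sub_le_of_norm_hasDerivWithin_le
    (f := expRem) (f' := fun w => Complex.exp w - 1)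
    (fun x _ => (hasDerivAt_expRem x).hasDerivWithinAt) (fun x hx => ?_)
    ⟨hw', by simpa using hr'⟩ ⟨hw, by simpa using hr⟩
  exact le_min (norm_exp_sub_one_le_two hx.1)
    ((norm_exp_sub_one_le hx.1).trans (by simpa using hx.2))

lemma norm_expRem_le {w : ℂ} (hw : w.re ≤ 0) : ‖expRem w‖ ≤ ‖w‖ ^ 2 := by
  have h := norm_expRem_sub_le (w' := 0) hw (by simp) le_rfl (by simp)
  simp only [expRem, Complex.exp_zero, sub_self, sub_zero] at h ⊢
  refine h.trans ?_
  rw [sq]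
  gcongr
  exact min_le_right _ _

lemma norm_expRem_sub_sq_le {w : ℂ} (hw : w.re ≤ 0) : ‖expRem w - w ^ 2 / 2‖ ≤ ‖w‖ ^ 3 := by
  have hd : ∀ x : ℂ, HasDerivAt (fun w => expRem w - w ^ 2 / 2) (expRem x) x := by
    intro x
    have := (hasDerivAt_expRem x).sub ((hasDerivAt_pow 2 x).div_const 2)
    refine this.congr_deriv ?_
    simp [expRem]
  have h := (convex_leftHalfBall ‖w‖).norm_image_sub_le_of_norm_hasDerivWithin_le
    (f := fun w => expRem w - w ^ 2 / 2) (f' := expRem) (C := ‖w‖ ^ 2) (x := 0) (y := w)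
    (fun x _ => (hd x).hasDerivWithinAt) (fun x hx => ?_) ⟨by simp, by simp⟩ ⟨hw, by simp⟩
  · simp only [expRem, Complex.exp_zero, sub_self, sub_zero] at h ⊢
    simpa [pow_succ] using h
  · refine (norm_expRem_le hx.1).trans ?_
    have : ‖x‖ ≤ ‖w‖ := by simpa using hx.2
    gcongr

end ComplexExp

/-- The pairing `⟨u,z⟩`. -/
def pairing (u : ℂ × ℂ) (z : ℝ × ℝ) : ℂ := u.1 * (z.1 : ℂ) + u.2 * (z.2 : ℂ)

/-- The weight integrated by the branching Lévy measure. -/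
def levyWeight (z : ℝ × ℝ) : ℝ := min z.1 (z.1 ^ 2) + z.2 ^ 2

lemma measurable_levyWeight : Measurable levyWeight := by unfold levyWeight; fun_prop

lemma levyWeight_nonneg {z : ℝ × ℝ} (hz : 0 ≤ z.1) : 0 ≤ levyWeight z := by
  unfold levyWeight; positivity

lemma norm_pairing_le {u : ℂ × ℂ} {R : ℝ} (h1 : ‖u.1‖ ≤ R) (h2 : ‖u.2‖ ≤ R) {z : ℝ × ℝ}
    (hz : 0 ≤ z.1) : ‖pairing u z‖ ≤ R * (z.1 + |z.2|) := by
  refine (norm_add_le _ _).trans ?_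
  rw [norm_mul, norm_mul, Complex.norm_real, Complex.norm_real, Real.norm_of_nonneg hz,
    Real.norm_eq_abs, mul_add]
  gcongr

lemma norm_expRem_pairing_sub_le {u u' : ℂ × ℂ} {R : ℝ} (hu : u.1.re ≤ 0) (hu' : u'.1.re ≤ 0)
    (hu2 : u.2.re = 0) (heq : u.2 = u'.2) (h1 : ‖u.1‖ ≤ R) (h1' : ‖u'.1‖ ≤ R) (h2 : ‖u.2‖ ≤ R)
    {z : ℝ × ℝ} (hz : 0 ≤ z.1) :
    ‖expRem (pairing u z) - expRem (pairing u' z)‖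
      ≤ (2 + 2 * R) * ‖u.1 - u'.1‖ * levyWeight z := by
  have hR : 0 ≤ R := (norm_nonneg _).trans h1
  have h := norm_expRem_sub_le (re_pairing_nonpos hu hu2 hz)
    (re_pairing_nonpos hu' (heq ▸ hu2) hz) (norm_pairing_le h1 h2 hz)
    (norm_pairing_le h1' (heq ▸ h2) hz)
  refine h.trans ?_
  have hd : pairing u z - pairing u' z = (u.1 - u'.1) * (z.1 : ℂ) := by
    simp only [pairing, heq]; ring
  change _ * ‖pairing u z - pairing u' z‖ ≤ _
  rw [hd, norm_mul, Complex.norm_real, Real.norm_of_nonneg hz]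
  have key : min 2 (R * (z.1 + |z.2|)) * z.1 ≤ (2 + 2 * R) * levyWeight z := by
    unfold levyWeight
    rcases le_total z.1 1 with hz1 | hz1
    · rw [min_eq_right (a := z.1) (by nlinarith)]
      calc _ ≤ R * (z.1 + |z.2|) * z.1 := by gcongr; exact min_le_right _ _
        _ ≤ _ := by
          nlinarith [mul_nonneg hR (sq_nonneg (z.1 - |z.2|)), sq_abs z.2, sq_nonneg z.1,
            sq_nonneg z.2, mul_nonneg hR (sq_nonneg z.1), mul_nonneg hR (sq_nonneg z.2)]
    · rw [min_eq_left (a := z.1) (by nlinarith)]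
      calc _ ≤ 2 * z.1 := by gcongr; exact min_le_left _ _
        _ ≤ _ := by
          nlinarith [mul_nonneg hR hz, sq_nonneg z.2, mul_nonneg hR (sq_nonneg z.2)]
  calc _ = min 2 (R * (z.1 + |z.2|)) * z.1 * ‖u.1 - u'.1‖ := by ring
    _ ≤ (2 + 2 * R) * levyWeight z * ‖u.1 - u'.1‖ := by gcongr
    _ = _ := by ring

lemma norm_expRem_pairing_le {u : ℂ × ℂ} {R : ℝ} (hu : u.1.re ≤ 0) (hu2 : u.2.re = 0)
    (h1 : ‖u.1‖ ≤ R) (h2 : ‖u.2‖ ≤ R) {z : ℝ × ℝ} (hz : 0 ≤ z.1) :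
    ‖expRem (pairing u z)‖ ≤ (2 * R + 3 * R ^ 2) * levyWeight z := by
  have hR : 0 ≤ R := (norm_nonneg _).trans h1
  have h := norm_expRem_pairing_sub_le (u := u) (u' := (0, u.2)) hu (by simp) hu2 rfl h1
    (by simpa using hR) h2 hz
  have h' := norm_expRem_le (w := pairing (0, u.2) z) (re_pairing_nonpos (u := (0, u.2)) (by simp) hu2 hz)
  have h0 : ‖pairing (0, u.2) z‖ ^ 2 ≤ R ^ 2 * levyWeight z := by
    simp only [pairing, zero_mul, zero_add, norm_mul, Complex.norm_real, Real.norm_eq_abs, mul_pow,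
      sq_abs]
    have hm : 0 ≤ min z.1 (z.1 ^ 2) := by positivity
    have : z.2 ^ 2 ≤ levyWeight z := by unfold levyWeight; linarith
    gcongr
  have hW := levyWeight_nonneg hz
  have hu1 : (2 + 2 * R) * ‖u.1 - 0‖ * levyWeight z ≤ (2 + 2 * R) * R * levyWeight z := by
    rw [sub_zero]; gcongr
  calc _ = ‖(expRem (pairing u z) - expRem (pairing (0, u.2) z)) + expRem (pairing (0, u.2) z)‖ := by
        rw [sub_add_cancel]
    _ ≤ (2 + 2 * R) * R * levyWeight z + R ^ 2 * levyWeight z :=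
        (norm_add_le _ _).trans (add_le_add (h.trans hu1) (h'.trans h0))
    _ = _ := by ring

lemma measurable_expRem_pairing (u : ℂ × ℂ) : Measurable fun z => expRem (pairing u z) := by
  unfold expRem pairing; fun_prop

section LevyExponent

variable {ρ : Measure (ℝ × ℝ)} (hρ : ∀ᵐ z ∂ρ, 0 ≤ z.1) (hW : Integrable levyWeight ρ)

lemma levyExponent_eq_expRem (a₁ b₁ : ℝ) (ρ : Measure (ℝ × ℝ)) (u : ℂ × ℂ) :
    levyExponent a₁ b₁ ρ u
      = -(a₁ : ℂ) * u.1 - (b₁ : ℂ) * u.2 + ∫ z, expRem (pairing u z) ∂ρ := rfl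

include hρ hW

lemma integrable_expRem_pairing {u : ℂ × ℂ} (hu : u.1.re ≤ 0) (hu2 : u.2.re = 0) :
    Integrable (fun z => expRem (pairing u z)) ρ := by
  refine Integrable.mono' (hW.const_mul (2 * max ‖u.1‖ ‖u.2‖ + 3 * max ‖u.1‖ ‖u.2‖ ^ 2))
    (measurable_expRem_pairing u).aestronglyMeasurable ?_
  filter_upwards [hρ] with z hz
  exact norm_expRem_pairing_le hu hu2 (le_max_left _ _) (le_max_right _ _) hz

lemma norm_integral_expRem_le {u : ℂ × ℂ} {R : ℝ} (hu : u.1.re ≤ 0) (hu2 : u.2.re = 0)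
    (h1 : ‖u.1‖ ≤ R) (h2 : ‖u.2‖ ≤ R) :
    ‖∫ z, expRem (pairing u z) ∂ρ‖ ≤ (2 * R + 3 * R ^ 2) * ∫ z, levyWeight z ∂ρ := by
  rw [← integral_const_mul]
  refine norm_integral_le_of_norm_le (hW.const_mul _) ?_
  filter_upwards [hρ] with z hz using norm_expRem_pairing_le hu hu2 h1 h2 hz

lemma norm_levyExponent_sub_le {u u' : ℂ × ℂ} {R : ℝ} (a₁ b₁ : ℝ) (hu : u.1.re ≤ 0)
    (hu' : u'.1.re ≤ 0) (hu2 : u.2.re = 0) (heq : u.2 = u'.2) (h1 : ‖u.1‖ ≤ R)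
    (h1' : ‖u'.1‖ ≤ R) (h2 : ‖u.2‖ ≤ R) :
    ‖levyExponent a₁ b₁ ρ u - levyExponent a₁ b₁ ρ u'‖
      ≤ (|a₁| + (2 + 2 * R) * ∫ z, levyWeight z ∂ρ) * ‖u.1 - u'.1‖ := by
  have hi := integrable_expRem_pairing hρ hW hu hu2
  have hi' := integrable_expRem_pairing hρ hW hu' (heq ▸ hu2)
  have h : levyExponent a₁ b₁ ρ u - levyExponent a₁ b₁ ρ u'
      = -(a₁ : ℂ) * (u.1 - u'.1)
        + ∫ z, (expRem (pairing u z) - expRem (pairing u' z)) ∂ρ := by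
    rw [levyExponent_eq_expRem, levyExponent_eq_expRem, integral_sub hi hi', heq]
    ring
  have h3 : ‖∫ z, (expRem (pairing u z) - expRem (pairing u' z)) ∂ρ‖
      ≤ (2 + 2 * R) * ‖u.1 - u'.1‖ * ∫ z, levyWeight z ∂ρ := by
    rw [← integral_const_mul]
    refine norm_integral_le_of_norm_le (hW.const_mul _) ?_
    filter_upwards [hρ] with z hz
    exact norm_expRem_pairing_sub_le hu hu' hu2 heq h1 h1' h2 hz
  rw [h]
  refine (norm_add_le _ _).trans ?_
  rw [norm_mul, norm_neg, Complex.norm_real, Real.norm_eq_abs]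
  linarith

end LevyExponent

/-- The jumps retained at truncation level `n`. -/
def truncSet (n : ℕ) : Set (ℝ × ℝ) :=
  {z | z.1 ≤ n + 1} ∩ {z | (1 : ℝ) / (n + 1) ≤ levyWeight z}

lemma measurableSet_truncSet (n : ℕ) : MeasurableSet (truncSet n) :=
  (measurableSet_le measurable_fst measurable_const).inter
    (measurableSet_le measurable_const measurable_levyWeight)

/-- The small jump whose rescaled Poisson sum approximates a degenerate Gaussian part. -/
def smallJump (n : ℕ) (α β : ℝ) : ℝ × ℝ := (Real.sqrt α / (n + 1), Real.sqrt β / (n + 1))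

/-- A finite measure approximating the Lévy measure together with the diffusion part. -/
def approxLevy (m : Measure (ℝ × ℝ)) (α₁₁ α₁₂ α₂₁ α₂₂ : ℝ) (n : ℕ) : Measure (ℝ × ℝ) :=
  m.restrict (truncSet n) + (ENNReal.ofReal (2 * (n + 1) ^ 2) • Measure.dirac (smallJump n α₁₁ α₂₁)
    + ENNReal.ofReal (2 * (n + 1) ^ 2) • Measure.dirac (smallJump n α₁₂ α₂₂))

lemma tendsto_setIntegral_compl_truncSet {m : Measure (ℝ × ℝ)} (hm : ∀ᵐ z ∂m, 0 ≤ z.1)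
    (hW : Integrable levyWeight m) :
    Tendsto (fun n => ∫ z in (truncSet n)ᶜ, levyWeight z ∂m) atTop (𝓝 0) := by
  have h : ∀ n, ∫ z in (truncSet n)ᶜ, levyWeight z ∂m
      = ∫ z, ((truncSet n)ᶜ).indicator levyWeight z ∂m := fun n =>
    (integral_indicator (measurableSet_truncSet n).compl).symm
  simp_rw [h]
  rw [← integral_zero (ℝ × ℝ) ℝ (μ := m)]
  refine tendsto_integral_of_dominated_convergence (fun z => ‖levyWeight z‖)
    (fun n => (measurable_levyWeight.indicator
      (measurableSet_truncSet n).compl).aestronglyMeasurable) hW.norm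
    (fun n => Eventually.of_forall fun z => norm_indicator_le_norm_self _ _) ?_
  filter_upwards [hm] with z hz
  rcases eq_or_ne (levyWeight z) 0 with h0 | h0
  · refine tendsto_const_nhds.congr fun n => ?_
    simp [indicator, h0]
  · have hpos : 0 < levyWeight z := lt_of_le_of_ne (levyWeight_nonneg hz) h0.symm
    refine tendsto_const_nhds.congr' ?_
    have h1 : ∀ᶠ n : ℕ in atTop, z.1 ≤ n + 1 := by
      filter_upwards [eventually_ge_atTop ⌈z.1⌉₊] with n hn
      have := (Nat.le_ceil z.1).trans (Nat.cast_le.2 hn)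
      linarith
    have h2 : ∀ᶠ n : ℕ in atTop, (1 : ℝ) / (n + 1) ≤ levyWeight z := by
      filter_upwards [(tendsto_one_div_add_atTop_nhds_zero_nat (𝕜 := ℝ)).eventually
        (gt_mem_nhds hpos)] with n hn using hn.le
    filter_upwards [h1, h2] with n hn1 hn2
    rw [indicator_of_notMem]
    exact fun h => h ⟨hn1, hn2⟩

section Approx

variable {m : Measure (ℝ × ℝ)} (hm : ∀ᵐ z ∂m, 0 ≤ z.1) (hW : Integrable levyWeight m)
  {α₁₁ α₁₂ α₂₁ α₂₂ : ℝ} (h₁₁ : 0 ≤ α₁₁) (h₁₂ : 0 ≤ α₁₂) (h₂₁ : 0 ≤ α₂₁) (h₂₂ : 0 ≤ α₂₂)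

lemma smallJump_fst_nonneg (n : ℕ) (α β : ℝ) : 0 ≤ (smallJump n α β).1 := by
  simp only [smallJump]; positivity

lemma mul_snd_smallJump_sq {α β : ℝ} (hβ : 0 ≤ β) (n : ℕ) :
    2 * ((n : ℝ) + 1) ^ 2 * (smallJump n α β).2 ^ 2 = 2 * β := by
  have : (n : ℝ) + 1 ≠ 0 := by positivity
  simp only [smallJump, div_pow, Real.sq_sqrt hβ]
  field_simp

lemma mul_fst_smallJump_sq {α β : ℝ} (hα : 0 ≤ α) (n : ℕ) :
    2 * ((n : ℝ) + 1) ^ 2 * (smallJump n α β).1 ^ 2 = 2 * α := by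
  have : (n : ℝ) + 1 ≠ 0 := by positivity
  simp only [smallJump, div_pow, Real.sq_sqrt hα]
  field_simp

lemma mul_levyWeight_smallJump_le {α β : ℝ} (hα : 0 ≤ α) (hβ : 0 ≤ β) (n : ℕ) :
    2 * ((n : ℝ) + 1) ^ 2 * levyWeight (smallJump n α β) ≤ 2 * (α + β) := by
  have h1 := mul_fst_smallJump_sq (β := β) hα n
  have h2 := mul_snd_smallJump_sq (α := α) hβ n
  have h3 : levyWeight (smallJump n α β)
      ≤ (smallJump n α β).1 ^ 2 + (smallJump n α β).2 ^ 2 :=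
    add_le_add_left (min_le_right _ _) _
  nlinarith [mul_le_mul_of_nonneg_left h3 (by positivity : (0:ℝ) ≤ 2 * ((n : ℝ) + 1) ^ 2)]

lemma integrable_approxLevy {E : Type*} [NormedAddCommGroup E] {f : ℝ × ℝ → E} {n : ℕ}
    (hf : IntegrableOn f (truncSet n) m) :
    Integrable f (approxLevy m α₁₁ α₁₂ α₂₁ α₂₂ n) :=
  Integrable.add_measure hf (Integrable.add_measure
    ((integrable_dirac (by simp)).smul_measure ENNReal.ofReal_ne_top)
    ((integrable_dirac (by simp)).smul_measure ENNReal.ofReal_ne_top))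

lemma integral_approxLevy {E : Type*} [NormedAddCommGroup E] [NormedSpace ℝ E] [CompleteSpace E]
    {f : ℝ × ℝ → E} {n : ℕ} (hf : IntegrableOn f (truncSet n) m) :
    ∫ z, f z ∂(approxLevy m α₁₁ α₁₂ α₂₁ α₂₂ n) = ∫ z in truncSet n, f z ∂m
      + ((2 * ((n : ℝ) + 1) ^ 2) • f (smallJump n α₁₁ α₂₁)
        + (2 * ((n : ℝ) + 1) ^ 2) • f (smallJump n α₁₂ α₂₂)) := by
  have hd : ∀ p : ℝ × ℝ, Integrable f (ENNReal.ofReal (2 * ((n : ℝ) + 1) ^ 2) • Measure.dirac p) :=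
    fun p => (integrable_dirac (by simp)).smul_measure ENNReal.ofReal_ne_top
  rw [approxLevy, integral_add_measure hf ((hd _).add_measure (hd _)),
    integral_add_measure (hd _) (hd _), integral_smul_measure, integral_smul_measure,
    integral_dirac, integral_dirac, ENNReal.toReal_ofReal (by positivity)]

include hm in
lemma ae_approxLevy_nonneg (n : ℕ) : ∀ᵐ z ∂(approxLevy m α₁₁ α₁₂ α₂₁ α₂₂ n), 0 ≤ z.1 := by
  have hd : ∀ α β : ℝ, ∀ᵐ z ∂(ENNReal.ofReal (2 * ((n : ℝ) + 1) ^ 2)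
      • Measure.dirac (smallJump n α β)), 0 ≤ z.1 := by
    intro α β
    refine Measure.ae_smul_measure ?_ _
    rw [ae_dirac_iff (measurableSet_le measurable_const measurable_fst)]
    exact smallJump_fst_nonneg n α β
  rw [approxLevy, ae_add_measure_iff, ae_add_measure_iff]
  exact ⟨ae_restrict_of_ae hm, hd _ _, hd _ _⟩

include hW in
lemma measure_truncSet_lt_top (n : ℕ) : m (truncSet n) < ⊤ := by
  refine (measure_mono fun z hz => ?_).trans_lt
    (hW.measure_norm_ge_lt_top (ε := (1 : ℝ) / (n + 1)) (by positivity))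
  have h : (1 : ℝ) / (n + 1) ≤ levyWeight z := hz.2
  exact h.trans (le_abs_self _)

include hW in
lemma isFiniteMeasure_approxLevy (n : ℕ) :
    IsFiniteMeasure (approxLevy m α₁₁ α₁₂ α₂₁ α₂₂ n) := by
  have h1 : IsFiniteMeasure (m.restrict (truncSet n)) :=
    ⟨by simpa using measure_truncSet_lt_top hW n⟩
  have h2 : ∀ p : ℝ × ℝ, IsFiniteMeasure (ENNReal.ofReal (2 * ((n : ℝ) + 1) ^ 2)
      • Measure.dirac p) := fun p => Measure.smul_finite _ ENNReal.ofReal_ne_top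
  have := h2 (smallJump n α₁₁ α₂₁)
  have := h2 (smallJump n α₁₂ α₂₂)
  unfold approxLevy
  infer_instance

include hm hW

lemma integrable_snd_sq : Integrable (fun z => z.2 ^ 2) m := by
  refine hW.mono' (by fun_prop) ?_
  filter_upwards [hm] with z hz
  rw [Real.norm_of_nonneg (sq_nonneg _)]
  have : 0 ≤ min z.1 (z.1 ^ 2) := by positivity
  unfold levyWeight
  linarith

lemma integrable_sq_approxLevy (n : ℕ) :
    Integrable (fun z => z.1 ^ 2) (approxLevy m α₁₁ α₁₂ α₂₁ α₂₂ n) ∧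
      Integrable (fun z => z.2 ^ 2) (approxLevy m α₁₁ α₁₂ α₂₁ α₂₂ n) := by
  refine ⟨integrable_approxLevy ?_, integrable_approxLevy (integrable_snd_sq hm hW).integrableOn⟩
  refine Measure.integrableOn_of_bounded (M := ((n : ℝ) + 1) ^ 2)
    (measure_truncSet_lt_top hW n).ne (by fun_prop) ?_
  filter_upwards [ae_restrict_of_ae hm, ae_restrict_mem (measurableSet_truncSet n)] with z hz hzn
  rw [Real.norm_of_nonneg (sq_nonneg _)]
  exact pow_le_pow_left₀ hz hzn.1 2

omit hm in
lemma integrable_levyWeight_approxLevy (n : ℕ) :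
    Integrable levyWeight (approxLevy m α₁₁ α₁₂ α₂₁ α₂₂ n) := integrable_approxLevy hW.integrableOn

include h₁₁ h₁₂ h₂₁ h₂₂ in
lemma integral_levyWeight_approxLevy_le (n : ℕ) :
    ∫ z, levyWeight z ∂(approxLevy m α₁₁ α₁₂ α₂₁ α₂₂ n)
      ≤ ∫ z, levyWeight z ∂m + (2 * (α₁₁ + α₂₁) + 2 * (α₁₂ + α₂₂)) := by
  rw [integral_approxLevy hW.integrableOn]
  refine add_le_add ?_ (add_le_add (mul_levyWeight_smallJump_le h₁₁ h₂₁ n)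
    (mul_levyWeight_smallJump_le h₁₂ h₂₂ n))
  refine setIntegral_le_integral hW ?_
  filter_upwards [hm] with z hz using levyWeight_nonneg hz

include h₂₁ h₂₂ in
lemma integral_snd_sq_approxLevy_le (n : ℕ) :
    ∫ z, z.2 ^ 2 ∂(approxLevy m α₁₁ α₁₂ α₂₁ α₂₂ n) ≤ ∫ z, z.2 ^ 2 ∂m + (2 * α₂₁ + 2 * α₂₂) := by
  rw [integral_approxLevy (integrable_snd_sq hm hW).integrableOn]
  refine add_le_add ?_ (add_le_add (mul_snd_smallJump_sq h₂₁ n).le (mul_snd_smallJump_sq h₂₂ n).le)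
  exact setIntegral_le_integral (integrable_snd_sq hm hW)
    (Eventually.of_forall fun z => sq_nonneg _)

omit hm hW in
lemma norm_expRem_smallJump_sub_le {u : ℂ × ℂ} {R : ℝ} (hu : u.1.re ≤ 0) (hu2 : u.2.re = 0)
    (h1 : ‖u.1‖ ≤ R) (h2 : ‖u.2‖ ≤ R) (α β : ℝ) (n : ℕ) :
    ‖(2 * ((n : ℝ) + 1) ^ 2) • expRem (pairing u (smallJump n α β))
        - ((Real.sqrt α : ℂ) * u.1 + (Real.sqrt β : ℂ) * u.2) ^ 2‖
      ≤ 2 * (R * (Real.sqrt α + Real.sqrt β)) ^ 3 * (1 / (n + 1)) := by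
  have hn : (0 : ℝ) < (n : ℝ) + 1 := by positivity
  have hnC : ((n : ℂ) + 1) ≠ 0 := by exact_mod_cast hn.ne'
  have h := norm_expRem_sub_sq_le (w := pairing u (smallJump n α β))
    (re_pairing_nonpos hu hu2 (smallJump_fst_nonneg n α β))
  have hp := norm_pairing_le h1 h2 (smallJump_fst_nonneg n α β)
  have hp' : R * ((smallJump n α β).1 + |(smallJump n α β).2|)
      = R * (Real.sqrt α + Real.sqrt β) / (n + 1) := by
    simp only [smallJump, abs_div, abs_of_nonneg (Real.sqrt_nonneg β), abs_of_pos hn]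
    ring
  rw [hp'] at hp
  have he : (2 * ((n : ℝ) + 1) ^ 2) • expRem (pairing u (smallJump n α β))
        - ((Real.sqrt α : ℂ) * u.1 + (Real.sqrt β : ℂ) * u.2) ^ 2
      = (2 * ((n : ℝ) + 1) ^ 2) • (expRem (pairing u (smallJump n α β))
        - pairing u (smallJump n α β) ^ 2 / 2) := by
    rw [smul_sub]
    congr 1
    simp only [pairing, smallJump, Complex.real_smul]
    push_cast
    field_simp
  rw [he, norm_smul, Real.norm_of_nonneg (by positivity)]
  calc _ ≤ 2 * ((n : ℝ) + 1) ^ 2 * (R * (Real.sqrt α + Real.sqrt β) / (n + 1)) ^ 3 := by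
        gcongr
        exact h.trans (by gcongr)
    _ = _ := by field_simp

include h₁₁ h₁₂ h₂₁ h₂₂ in
lemma eventually_norm_levyExponent_sub_phi_le (a₁ b₁ R : ℝ) {η : ℝ} (hη : 0 < η) :
    ∀ᶠ n : ℕ in atTop, ∀ u : ℂ × ℂ, u.1.re ≤ 0 → u.2.re = 0 → ‖u.1‖ ≤ R → ‖u.2‖ ≤ R →
      ‖levyExponent a₁ b₁ (approxLevy m α₁₁ α₁₂ α₂₁ α₂₂ n) u
        - phi a₁ b₁ α₁₁ α₁₂ α₂₁ α₂₂ m u‖ ≤ η := by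
  set B : ℕ → ℝ := fun n => (2 * R + 3 * R ^ 2) * (∫ z in (truncSet n)ᶜ, levyWeight z ∂m)
    + 2 * (R * (Real.sqrt α₁₁ + Real.sqrt α₂₁)) ^ 3 * (1 / (n + 1))
    + 2 * (R * (Real.sqrt α₁₂ + Real.sqrt α₂₂)) ^ 3 * (1 / (n + 1)) with hB
  have hlim : Tendsto B atTop (𝓝 0) := by
    have h0 := tendsto_one_div_add_atTop_nhds_zero_nat (𝕜 := ℝ)
    have := (((tendsto_setIntegral_compl_truncSet hm hW).const_mul (2 * R + 3 * R ^ 2)).add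
      (h0.const_mul (2 * (R * (Real.sqrt α₁₁ + Real.sqrt α₂₁)) ^ 3))).add
      (h0.const_mul (2 * (R * (Real.sqrt α₁₂ + Real.sqrt α₂₂)) ^ 3))
    rw [mul_zero, mul_zero, mul_zero, add_zero, add_zero] at this
    exact this
  filter_upwards [hlim.eventually (gt_mem_nhds hη)] with n hn u hu hu2 h1 h2
  refine le_trans ?_ hn.le
  have hi := integrable_expRem_pairing hm hW hu hu2
  have hsplit := integral_add_compl (measurableSet_truncSet n) hi
  have hphi : phi a₁ b₁ α₁₁ α₁₂ α₂₁ α₂₂ m u = -(a₁ : ℂ) * u.1 - (b₁ : ℂ) * u.2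
      + ((Real.sqrt α₁₁ : ℂ) * u.1 + (Real.sqrt α₂₁ : ℂ) * u.2) ^ 2
      + ((Real.sqrt α₁₂ : ℂ) * u.1 + (Real.sqrt α₂₂ : ℂ) * u.2) ^ 2
      + ∫ z, expRem (pairing u z) ∂m := by
    have hsq : ∀ {α : ℝ}, 0 ≤ α → (Real.sqrt α : ℂ) ^ 2 = α := fun h => by
      exact_mod_cast Real.sq_sqrt h
    change _ + ∫ z, expRem (pairing u z) ∂m = _
    rw [Real.sqrt_mul h₁₁, Real.sqrt_mul h₁₂]
    push_cast
    rw [← hsq h₁₁, ← hsq h₁₂, ← hsq h₂₁, ← hsq h₂₂]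
    ring
  have hd : levyExponent a₁ b₁ (approxLevy m α₁₁ α₁₂ α₂₁ α₂₂ n) u
        - phi a₁ b₁ α₁₁ α₁₂ α₂₁ α₂₂ m u
      = -(∫ z in (truncSet n)ᶜ, expRem (pairing u z) ∂m)
        + ((2 * ((n : ℝ) + 1) ^ 2) • expRem (pairing u (smallJump n α₁₁ α₂₁))
          - ((Real.sqrt α₁₁ : ℂ) * u.1 + (Real.sqrt α₂₁ : ℂ) * u.2) ^ 2)
        + ((2 * ((n : ℝ) + 1) ^ 2) • expRem (pairing u (smallJump n α₁₂ α₂₂))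
          - ((Real.sqrt α₁₂ : ℂ) * u.1 + (Real.sqrt α₂₂ : ℂ) * u.2) ^ 2) := by
    rw [levyExponent_eq_expRem, integral_approxLevy hi.integrableOn, hphi, ← hsplit]
    ring
  rw [hd]
  refine (norm_add₃_le).trans (add_le_add (add_le_add ?_
    (norm_expRem_smallJump_sub_le hu hu2 h1 h2 _ _ n))
    (norm_expRem_smallJump_sub_le hu hu2 h1 h2 _ _ n))
  rw [norm_neg]
  exact norm_integral_expRem_le (ae_restrict_of_ae hm) hW.integrableOn hu hu2 h1 h2

end Approx

/-- Discrete Gronwall estimate for a perturbed Euler scheme. -/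
lemma norm_euler_sub_le {v F : ℝ → ℂ} {w : ℕ → ℂ} {s η L : ℝ} {N : ℕ} (hs : 0 ≤ s) (hη : 0 ≤ η)
    (hL : 0 ≤ L) (h0 : w 0 = v 0)
    (hcons : ∀ j : ℕ, j < N → ‖v ((j + 1 : ℕ) * s) - v (j * s) - s * F (j * s)‖ ≤ s * η)
    (hstab : ∀ j : ℕ, j < N → ‖w j - v (j * s)‖ ≤ 1 →
      ‖w (j + 1) - w j - s * F (j * s)‖ ≤ s * (L * ‖w j - v (j * s)‖ + η))
    (hsmall : 2 * η * (N * s) * Real.exp (L * (N * s)) ≤ 1) (j : ℕ) (hj : j ≤ N) :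
    ‖w j - v (j * s)‖ ≤ 2 * η * (j * s) * Real.exp (L * (j * s)) := by
  induction j with
  | zero => simp [h0]
  | succ j ih =>
    have hjN : j < N := hj
    have ih := ih hjN.le
    have hjN' : (j : ℝ) ≤ N := by exact_mod_cast hjN.le
    have hle : ‖w j - v (j * s)‖ ≤ 1 := by
      refine ih.trans (le_trans ?_ hsmall)
      gcongr
    have h1 := hcons j hjN
    have h2 := hstab j hjN hle
    have hsplit : w (j + 1) - v ((j + 1 : ℕ) * s) = (w j - v (j * s))
        + (w (j + 1) - w j - s * F (j * s))
        + -(v ((j + 1 : ℕ) * s) - v (j * s) - s * F (j * s)) := by ring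
    have h3 : ‖w (j + 1) - v ((j + 1 : ℕ) * s)‖
        ≤ (1 + L * s) * ‖w j - v (j * s)‖ + 2 * s * η := by
      rw [hsplit]
      refine norm_add₃_le.trans ?_
      rw [norm_neg]
      linarith
    have h4 : 1 + L * s ≤ Real.exp (L * s) := by linarith [Real.add_one_le_exp (L * s)]
    have h5 : Real.exp (L * ((j + 1 : ℕ) * s)) = Real.exp (L * s) * Real.exp (L * (j * s)) := by
      rw [← Real.exp_add]; congr 1; push_cast; ring
    have h6 : 1 ≤ Real.exp (L * ((j + 1 : ℕ) * s)) := Real.one_le_exp (by positivity)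
    calc _ ≤ Real.exp (L * s) * (2 * η * (j * s) * Real.exp (L * (j * s))) + 2 * s * η * 1 :=
          h3.trans (by rw [mul_one]; gcongr)
      _ ≤ Real.exp (L * s) * (2 * η * (j * s) * Real.exp (L * (j * s)))
          + 2 * s * η * Real.exp (L * ((j + 1 : ℕ) * s)) := by gcongr
      _ = _ := by rw [h5]; push_cast; ring

/-- Uniform consistency of the Euler scheme. -/
lemma norm_sub_sub_mul_le {v F : ℝ → ℂ} {r s η : ℝ} (hs : 0 ≤ s)
    (hv : ∀ x ∈ Icc r (r + s), HasDerivAt v (F x) x)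
    (hF : ∀ x ∈ Icc r (r + s), ‖F x - F r‖ ≤ η) :
    ‖v (r + s) - v r - s * F r‖ ≤ s * η := by
  have hd : ∀ x ∈ Icc r (r + s),
      HasDerivWithinAt (fun y : ℝ => v y - (y : ℂ) * F r) (F x - F r) (Icc r (r + s)) x := by
    intro x hx
    have h1 := (Complex.ofRealCLM.hasDerivAt (x := x)).mul_const (F r)
    have h2 := (hv x hx).sub h1
    refine (h2.congr_deriv ?_).hasDerivWithinAt
    simp
  have h := (convex_Icc r (r + s)).norm_image_sub_le_of_norm_hasDerivWithin_le hd hF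
    (left_mem_Icc.2 (by linarith)) (right_mem_Icc.2 (by linarith))
  calc _ = ‖v (r + s) - ((r + s : ℝ) : ℂ) * F r - (v r - (r : ℂ) * F r)‖ := by
        congr 1; push_cast; ring
    _ ≤ η * ‖r + s - r‖ := h
    _ = _ := by rw [add_sub_cancel_left, Real.norm_of_nonneg hs, mul_comm]

namespace AffineSemigroup

variable (S : AffineSemigroup)

lemma ae_m_nonneg : ∀ᵐ z ∂S.m, 0 ≤ z.1 := by
  refine measure_mono_null (fun z hz => ?_) S.m_supp
  exact Or.inl (not_le.1 hz)

lemma integrable_levyWeight : Integrable levyWeight S.m := by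
  refine ⟨measurable_levyWeight.aestronglyMeasurable, ?_⟩
  rw [hasFiniteIntegral_iff_ofReal]
  · exact S.m_int
  · filter_upwards [S.ae_m_nonneg] with z hz using levyWeight_nonneg hz

/-- The approximating finite Lévy measures. -/
def approx (n : ℕ) : Measure (ℝ × ℝ) := approxLevy S.m S.α₁₁ S.α₁₂ S.α₂₁ S.α₂₂ n

/-- The flow of the second coordinate. -/
def V₂ (t : ℝ) (u : ℂ × ℂ) : ℂ := Complex.exp (-(S.b₂ : ℂ) * (t : ℂ)) * u.2

/-- The function `φ` of the semigroup. -/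
def φ (u : ℂ × ℂ) : ℂ := phi S.a₁ S.b₁ S.α₁₁ S.α₁₂ S.α₂₁ S.α₂₂ S.m u

variable {S}

lemma V₂_eq (t : ℝ) (u : ℂ × ℂ) : S.V₂ t u = (Real.exp (-S.b₂ * t) : ℝ) * u.2 := by
  simp [V₂]

lemma V₂_re {u : ℂ × ℂ} (h2 : u.2.re = 0) (t : ℝ) : (S.V₂ t u).re = 0 := by
  simp [V₂_eq, h2, -Complex.ofReal_exp]

lemma norm_V₂_le (hb : 0 < 2 * S.b₂) {t : ℝ} (ht : 0 ≤ t) (u : ℂ × ℂ) : ‖S.V₂ t u‖ ≤ ‖u.2‖ := by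
  rw [V₂_eq, norm_mul, Complex.norm_real, Real.norm_of_nonneg (Real.exp_pos _).le]
  refine mul_le_of_le_one_left (norm_nonneg _) (Real.exp_le_one_iff.2 ?_)
  nlinarith

lemma continuousOn_V₁ {u : ℂ × ℂ} (h1 : u.1.re ≤ 0) (h2 : u.2.re = 0) (t : ℝ) :
    ContinuousOn (fun r => S.V₁ r u) (Icc 0 t) := fun r hr =>
  (S.V₁_ode u h1 h2 r hr.1).continuousAt.continuousWithinAt

lemma continuousOn_φ (hb : 0 < 2 * S.b₂) {u : ℂ × ℂ} (h1 : u.1.re ≤ 0) (h2 : u.2.re = 0) (t : ℝ) :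
    ContinuousOn (fun r => S.φ (S.V₁ r u, S.V₂ r u)) (Icc 0 t) := by
  have hv := continuousOn_V₁ (S := S) h1 h2 t
  have hv2 : ContinuousOn (fun r => S.V₂ r u) (Icc 0 t) := by
    unfold V₂; fun_prop
  obtain ⟨C, hC⟩ := isCompact_Icc.exists_bound_of_continuousOn hv
  have hInt : ContinuousOn (fun r => ∫ z, expRem (pairing (S.V₁ r u, S.V₂ r u) z) ∂S.m)
      (Icc 0 t) := by
    refine continuousOn_of_dominated (bound := fun z =>
      (2 * max C ‖u.2‖ + 3 * max C ‖u.2‖ ^ 2) * levyWeight z)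
      (fun r _ => (measurable_expRem_pairing _).aestronglyMeasurable) (fun r hr => ?_)
      (S.integrable_levyWeight.const_mul _) (Eventually.of_forall fun z => ?_)
    · filter_upwards [S.ae_m_nonneg] with z hz
      exact norm_expRem_pairing_le (S.V₁_mem u h1 h2 r hr.1) (V₂_re h2 r)
        ((hC r hr).trans (le_max_left _ _))
        ((norm_V₂_le hb hr.1 u).trans (le_max_right _ _)) hz
    · unfold expRem pairing
      fun_prop
  unfold φ phi
  exact ContinuousOn.add (by fun_prop) hInt

lemma eulerStep_iterate_snd (a₁ b₁ : ℝ) (ρ : Measure (ℝ × ℝ)) (s : ℝ) (u : ℂ × ℂ) (j : ℕ) :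
    ((eulerStep a₁ b₁ S.b₂ ρ s)^[j] u).2 = S.V₂ (j * s) u := by
  induction j with
  | zero => simp [V₂]
  | succ j ih =>
    rw [Function.iterate_succ_apply', eulerStep, ih, V₂_eq, V₂_eq, ← mul_assoc,
      ← Complex.ofReal_mul, ← Real.exp_add,
      show -S.b₂ * s + -S.b₂ * (j * s) = -S.b₂ * ((j + 1 : ℕ) * s) by push_cast; ring]

lemma integrable_approx (n : ℕ) : IsFiniteMeasure (S.approx n) ∧ Integrable Prod.fst (S.approx n) ∧
    Integrable Prod.snd (S.approx n) ∧ Integrable (fun z => z.1 ^ 2) (S.approx n) ∧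
    Integrable (fun z => z.2 ^ 2) (S.approx n) := by
  have hfin : IsFiniteMeasure (S.approx n) := isFiniteMeasure_approxLevy S.integrable_levyWeight n
  obtain ⟨h1, h2⟩ : Integrable (fun z => z.1 ^ 2) (S.approx n) ∧
      Integrable (fun z => z.2 ^ 2) (S.approx n) :=
    integrable_sq_approxLevy S.ae_m_nonneg S.integrable_levyWeight n
  refine ⟨hfin, ?_, ?_, h1, h2⟩
  · exact ((memLp_two_iff_integrable_sq (by fun_prop)).2 h1).integrable one_le_two
  · exact ((memLp_two_iff_integrable_sq (by fun_prop)).2 h2).integrable one_le_two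

lemma ae_approx_nonneg (n : ℕ) : ∀ᵐ z ∂(S.approx n), 0 ≤ z.1 :=
  ae_approxLevy_nonneg S.ae_m_nonneg n

lemma tendsto_eulerStep (hb : 0 < 2 * S.b₂) {t : ℝ} (ht : 0 ≤ t) {N : ℕ → ℕ}
    (hN : ∀ n, n + 1 ≤ N n)
    (hA : ∀ n, t / N n * (S.a₁ + ∫ z, z.1 ∂(S.approx n)) ≤ 1)
    {u : ℂ × ℂ} (h1 : u.1.re ≤ 0) (h2 : u.2.re = 0) :
    Tendsto (fun n => ((eulerStep S.a₁ S.b₁ S.b₂ (S.approx n) (t / N n))^[N n] u).1) atTop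
      (𝓝 (S.V₁ t u)) := by
  obtain ⟨C, hC⟩ := isCompact_Icc.exists_bound_of_continuousOn (continuousOn_V₁ (S := S) h1 h2 t)
  have hFc := continuousOn_φ hb h1 h2 t
  have hFu := isCompact_Icc.uniformContinuousOn_of_continuous hFc
  rw [Metric.uniformContinuousOn_iff] at hFu
  set F : ℝ → ℂ := fun r => S.φ (S.V₁ r u, S.V₂ r u) with hF
  set R : ℝ := max (C + 1) ‖u.2‖ with hR
  have hR0 : 0 ≤ R := (norm_nonneg _).trans (le_max_right _ _)
  set K : ℝ := ∫ z, levyWeight z ∂S.m + (2 * (S.α₁₁ + S.α₂₁) + 2 * (S.α₁₂ + S.α₂₂)) with hK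
  have hK0 : 0 ≤ K := by
    have : 0 ≤ ∫ z, levyWeight z ∂S.m := by
      refine integral_nonneg_of_ae ?_
      filter_upwards [S.ae_m_nonneg] with z hz using levyWeight_nonneg hz
    have := S.α₁₁_nonneg
    have := S.α₁₂_nonneg
    have := S.α₂₁_nonneg
    have := S.α₂₂_nonneg
    positivity
  set L : ℝ := |S.a₁| + (2 + 2 * R) * K with hL
  have hL0 : 0 ≤ L := by positivity
  rw [Metric.tendsto_atTop']
  intro ε hε
  set E : ℝ := 2 * t * Real.exp (L * t) + 1 with hE
  have hE0 : 0 < E := by positivity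
  set η : ℝ := min 1 (ε / 2) / E with hη
  have hη0 : 0 < η := by positivity
  have hηE : 2 * η * t * Real.exp (L * t) ≤ min 1 (ε / 2) := by
    have : η * E = min 1 (ε / 2) := by rw [hη]; field_simp
    nlinarith
  obtain ⟨δ, hδ, hδF⟩ := hFu η hη0
  have hev1 : ∀ᶠ n : ℕ in atTop, t * (1 / ((n : ℝ) + 1)) < δ := by
    have := (tendsto_one_div_add_atTop_nhds_zero_nat (𝕜 := ℝ)).const_mul t
    rw [mul_zero] at this
    exact this.eventually (gt_mem_nhds hδ)
  have hev2 := eventually_norm_levyExponent_sub_phi_le S.ae_m_nonneg S.integrable_levyWeight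
    S.α₁₁_nonneg S.α₁₂_nonneg S.α₂₁_nonneg S.α₂₂_nonneg S.a₁ S.b₁ R hη0
  obtain ⟨n₀, hn₀⟩ := eventually_atTop.1 (hev1.and hev2)
  refine ⟨n₀, fun n hn => ?_⟩
  obtain ⟨hδn, happ⟩ := hn₀ n hn.le
  set s : ℝ := t / N n with hs
  have hNpos : (0 : ℝ) < N n := by exact_mod_cast (Nat.succ_pos n).trans_le (hN n)
  have hs0 : 0 ≤ s := by positivity
  have hNs : N n * s = t := by rw [hs]; field_simp
  have hsδ : s < δ := by
    refine lt_of_le_of_lt ?_ hδn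
    rw [hs, div_eq_mul_one_div]
    gcongr
    exact_mod_cast hN n
  obtain ⟨hfin, hi1, hi2, -, -⟩ := integrable_approx (S := S) n
  have hjs : ∀ j : ℕ, j ≤ N n → (j : ℝ) * s ∈ Icc 0 t := by
    intro j hj
    refine ⟨by positivity, ?_⟩
    rw [← hNs]
    gcongr
  have hmem : ∀ j : ℕ, ((eulerStep S.a₁ S.b₁ S.b₂ (S.approx n) s)^[j] u).1.re ≤ 0 ∧
      ((eulerStep S.a₁ S.b₁ S.b₂ (S.approx n) s)^[j] u).2.re = 0 := by
    intro j
    induction j with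
    | zero => exact ⟨h1, h2⟩
    | succ j ih =>
      rw [Function.iterate_succ_apply']
      exact eulerStep_mem (ae_approx_nonneg n) hi1 hi2 hs0 (hA n) ih.1 ih.2
  have key := norm_euler_sub_le (v := fun r => S.V₁ r u) (F := F)
    (w := fun j => ((eulerStep S.a₁ S.b₁ S.b₂ (S.approx n) s)^[j] u).1) (N := N n)
    hs0 hη0.le hL0 (S.V₁_init u).symm ?_ ?_ ?_ (N n) le_rfl
  · rw [hNs] at key
    rw [dist_eq_norm]
    refine (key.trans hηE).trans_lt ((min_le_right _ _).trans_lt (by linarith))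
  · intro j hj
    have hsub : ∀ x ∈ Icc ((j : ℝ) * s) (j * s + s), x ∈ Icc 0 t := by
      intro x hx
      have := (hjs (j + 1) hj).2
      push_cast at this
      exact ⟨(hjs j hj.le).1.trans hx.1, hx.2.trans (by linarith)⟩
    have := norm_sub_sub_mul_le (v := fun r => S.V₁ r u) (F := F) (r := j * s) (η := η) hs0
      (fun x hx => S.V₁_ode u h1 h2 x (hsub x hx).1) (fun x hx => ?_)
    · rw [show ((j + 1 : ℕ) : ℝ) * s = j * s + s by push_cast; ring]
      exact this
    · rw [← dist_eq_norm]
      refine (hδF x (hsub x hx) (j * s) (hjs j hj.le) ?_).le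
      rw [Real.dist_eq, abs_of_nonneg (by linarith [hx.1])]
      linarith [hx.2]
  · intro j hj hle
    have hjt := hjs j hj.le
    have hw : (eulerStep S.a₁ S.b₁ S.b₂ (S.approx n) s)^[j] u
        = (((eulerStep S.a₁ S.b₁ S.b₂ (S.approx n) s)^[j] u).1, S.V₂ (j * s) u) :=
      Prod.ext rfl (eulerStep_iterate_snd _ _ _ _ _ _)
    set w := ((eulerStep S.a₁ S.b₁ S.b₂ (S.approx n) s)^[j] u).1 with hwdef
    have hvR : ‖S.V₁ (j * s) u‖ ≤ R := (hC _ hjt).trans (by rw [hR]; exact (by linarith : C ≤ C + 1).trans (le_max_left _ _))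
    have hwR : ‖w‖ ≤ R := by
      have h3 : ‖w‖ ≤ ‖w - S.V₁ (j * s) u‖ + ‖S.V₁ (j * s) u‖ := by
        simpa using norm_add_le (w - S.V₁ (j * s) u) (S.V₁ (j * s) u)
      have h4 := hC _ hjt
      have h5 : C + 1 ≤ R := le_max_left _ _
      linarith
    have hv2R : ‖S.V₂ (j * s) u‖ ≤ R := (norm_V₂_le hb hjt.1 u).trans (le_max_right _ _)
    have hvre := S.V₁_mem u h1 h2 _ hjt.1
    have hv2re : (S.V₂ (j * s) u).re = 0 := V₂_re h2 _
    have hlip := norm_levyExponent_sub_le (u := (w, S.V₂ (j * s) u))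
      (u' := (S.V₁ (j * s) u, S.V₂ (j * s) u)) (ae_approx_nonneg n)
      (integrable_levyWeight_approxLevy S.integrable_levyWeight n) S.a₁ S.b₁ (hmem j).1 hvre hv2re
      rfl hwR hvR hv2R
    have hcons := happ (S.V₁ (j * s) u, S.V₂ (j * s) u) hvre hv2re hvR hv2R
    have hKn : |S.a₁| + (2 + 2 * R) * ∫ z, levyWeight z ∂(S.approx n) ≤ L := by
      rw [hL]
      gcongr
      exact integral_levyWeight_approxLevy_le S.ae_m_nonneg S.integrable_levyWeight
        S.α₁₁_nonneg S.α₁₂_nonneg S.α₂₁_nonneg S.α₂₂_nonneg n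
    have hstep : ((eulerStep S.a₁ S.b₁ S.b₂ (S.approx n) s)^[j + 1] u).1
        = w + s * levyExponent S.a₁ S.b₁ (S.approx n) (w, S.V₂ (j * s) u) := by
      rw [Function.iterate_succ_apply', hw, eulerStep]
    have hdiff : ((eulerStep S.a₁ S.b₁ S.b₂ (S.approx n) s)^[j + 1] u).1 - w - s * F (j * s)
        = s * ((levyExponent S.a₁ S.b₁ (S.approx n) (w, S.V₂ (j * s) u)
            - levyExponent S.a₁ S.b₁ (S.approx n) (S.V₁ (j * s) u, S.V₂ (j * s) u))
          + (levyExponent S.a₁ S.b₁ (S.approx n) (S.V₁ (j * s) u, S.V₂ (j * s) u)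
            - F (j * s))) := by
      rw [hstep]; ring
    rw [hdiff, norm_mul, Complex.norm_real, Real.norm_of_nonneg hs0]
    refine mul_le_mul_of_nonneg_left ((norm_add_le _ _).trans (add_le_add ?_ hcons)) hs0
    exact hlip.trans (mul_le_mul_of_nonneg_right hKn (norm_nonneg _))
  · rw [hNs]
    exact hηE.trans (min_le_left _ _)

end AffineSemigroup

lemma lintegral_ofReal_abs_le_sqrt {α : Type*} [MeasurableSpace α] {μ : Measure α}
    [IsProbabilityMeasure μ] {f : α → ℝ} (hf : Measurable f) {M : ℝ} (hM : 0 ≤ M)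
    (h : ∫⁻ x, ENNReal.ofReal (f x ^ 2) ∂μ ≤ ENNReal.ofReal M) :
    ∫⁻ x, ENNReal.ofReal |f x| ∂μ ≤ ENNReal.ofReal (Real.sqrt M) := by
  have h1 := ENNReal.lintegral_mul_le_Lp_mul_Lq μ Real.HolderConjugate.two_two
    (f := fun x => ENNReal.ofReal |f x|) (g := fun _ => 1) (by fun_prop) (by fun_prop)
  simp only [Pi.mul_apply, mul_one, ENNReal.one_rpow, lintegral_const, measure_univ] at h1
  refine h1.trans ?_
  rw [Real.sqrt_eq_rpow, ← ENNReal.ofReal_rpow_of_nonneg hM (by norm_num)]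
  refine ENNReal.rpow_le_rpow (le_of_eq_of_le (lintegral_congr fun x => ?_) h) (by norm_num)
  rw [ENNReal.ofReal_rpow_of_nonneg (abs_nonneg _) (by norm_num), Real.rpow_two, sq_abs]

lemma norm_expPair_eq_one {u : ℂ × ℂ} (h1 : u.1.re = 0) (h2 : u.2.re = 0) (z : ℝ × ℝ) :
    ‖expPair u z‖ = 1 := by
  rw [expPair, Complex.norm_exp]
  simp [h1, h2]

/-- The bounded continuous function `expPair u` for `u ∈ iℝ²`. -/
def expPairBCF {u : ℂ × ℂ} (h1 : u.1.re = 0) (h2 : u.2.re = 0) :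
    BoundedContinuousFunction (ℝ × ℝ) ℂ :=
  BoundedContinuousFunction.ofNormedAddCommGroup (expPair u) (by unfold expPair; fun_prop) 1
    fun z => (norm_expPair_eq_one h1 h2 z).le

lemma isTightMeasureSet_of_lintegral_le {T : Set (Measure (ℝ × ℝ))} {A B : ℝ}
    (hA : ∀ μ ∈ T, ∫⁻ z, ENNReal.ofReal |z.1| ∂μ ≤ ENNReal.ofReal A)
    (hB : ∀ μ ∈ T, ∫⁻ z, ENNReal.ofReal |z.2| ∂μ ≤ ENNReal.ofReal B) :
    IsTightMeasureSet T := by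
  rw [isTightMeasureSet_iff_exists_isCompact_measure_compl_le]
  intro ε hε
  set D : ℝ≥0∞ := ENNReal.ofReal A + ENNReal.ofReal B with hD
  have hDtop : D ≠ ⊤ := by simp [hD]
  have hlim : Tendsto (fun r : ℕ => D / ENNReal.ofReal ((r : ℝ) + 1)) atTop (𝓝 0) := by
    have h1 : Tendsto (fun r : ℕ => ENNReal.ofReal ((r : ℝ) + 1)) atTop (𝓝 ⊤) :=
      ENNReal.tendsto_ofReal_atTop.comp
        (tendsto_atTop_add_const_right _ _ tendsto_natCast_atTop_atTop)
    have := ENNReal.Tendsto.const_div (a := D) h1 (Or.inr hDtop)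
    simpa using this
  obtain ⟨r, hr⟩ := (hlim.eventually (gt_mem_nhds hε)).exists
  refine ⟨Metric.closedBall 0 ((r : ℝ) + 1), isCompact_closedBall _ _, fun μ hμ => ?_⟩
  refine le_trans ?_ hr.le
  have hpos : ENNReal.ofReal ((r : ℝ) + 1) ≠ 0 := by
    simp only [ne_eq, ENNReal.ofReal_eq_zero, not_le]; positivity
  calc μ (Metric.closedBall 0 ((r : ℝ) + 1))ᶜ
      ≤ μ {z | ENNReal.ofReal ((r : ℝ) + 1) ≤ ENNReal.ofReal |z.1| + ENNReal.ofReal |z.2|} := by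
        refine measure_mono fun z hz => ?_
        simp only [mem_compl_iff, Metric.mem_closedBall, dist_zero_right, not_le] at hz
        rw [mem_ofPred_eq, ← ENNReal.ofReal_add (abs_nonneg _) (abs_nonneg _)]
        refine ENNReal.ofReal_le_ofReal (hz.le.trans ?_)
        rw [Prod.norm_def, Real.norm_eq_abs, Real.norm_eq_abs]
        exact max_le (le_add_of_nonneg_right (abs_nonneg _)) (le_add_of_nonneg_left (abs_nonneg _))
    _ ≤ (∫⁻ z, (ENNReal.ofReal |z.1| + ENNReal.ofReal |z.2|) ∂μ)
          / ENNReal.ofReal ((r : ℝ) + 1) :=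
        meas_ge_le_lintegral_div (by fun_prop) hpos ENNReal.ofReal_ne_top
    _ ≤ _ := by
        rw [lintegral_add_left (by fun_prop)]
        gcongr
        exact add_le_add (hA μ hμ) (hB μ hμ)

lemma lintegral_ofReal_abs_snd_le_of_tendsto {F : Filter ℕ} [F.NeBot]
    {μ : ℕ → ProbabilityMeasure (ℝ × ℝ)} {ν : ProbabilityMeasure (ℝ × ℝ)}
    (h : Tendsto μ F (𝓝 ν)) {B : ℝ≥0∞}
    (hB : ∀ n, ∫⁻ z, ENNReal.ofReal |z.2| ∂(μ n : Measure (ℝ × ℝ)) ≤ B) :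
    ∫⁻ z, ENNReal.ofReal |z.2| ∂(ν : Measure (ℝ × ℝ)) ≤ B := by
  have hmono : ∀ z : ℝ × ℝ, Monotone fun K : ℕ => ENNReal.ofReal (min |z.2| K) := by
    intro z K K' hK
    refine ENNReal.ofReal_le_ofReal (min_le_min_left _ ?_)
    exact_mod_cast hK
  have hsup : ∀ z : ℝ × ℝ, ENNReal.ofReal |z.2| = ⨆ K : ℕ, ENNReal.ofReal (min |z.2| K) := by
    intro z
    refine le_antisymm ?_ (iSup_le fun K => ENNReal.ofReal_le_ofReal (min_le_left _ _))
    obtain ⟨K, hK⟩ := exists_nat_ge |z.2|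
    refine le_iSup_of_le K ?_
    rw [min_eq_left hK]
  simp_rw [hsup]
  rw [lintegral_iSup (fun K => by fun_prop) (fun K K' hK z => hmono z hK)]
  refine iSup_le fun K => ?_
  let f : BoundedContinuousFunction (ℝ × ℝ) NNReal :=
    BoundedContinuousFunction.mkOfBound ⟨fun z => Real.toNNReal (min |z.2| K), by fun_prop⟩ K (by
      intro z w
      have hz : ∀ z : ℝ × ℝ, ((Real.toNNReal (min |z.2| K) : NNReal) : ℝ) ∈ Icc (0 : ℝ) K := by
        intro z
        rw [Real.coe_toNNReal _ (le_min (abs_nonneg _) (Nat.cast_nonneg _))]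
        exact ⟨le_min (abs_nonneg _) (Nat.cast_nonneg _), min_le_right _ _⟩
      have := Real.dist_le_of_mem_Icc (hz z) (hz w)
      simpa [NNReal.dist_eq, Real.dist_eq] using this)
  have ht := (ProbabilityMeasure.tendsto_iff_forall_lintegral_tendsto.1 h) f
  refine le_of_tendsto ht (Eventually.of_forall fun n => (lintegral_mono fun z => ?_).trans (hB n))
  exact ENNReal.ofReal_le_ofReal (min_le_left _ _)

/-- A sequence of laws with bounded first moments whose characteristic functions converge has a
limit law satisfying the same bound. -/
lemma exists_limit_law {μ : ℕ → ProbabilityMeasure (ℝ × ℝ)} {A B : ℝ}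
    (hA : ∀ n, ∫⁻ z, ENNReal.ofReal |z.1| ∂(μ n : Measure (ℝ × ℝ)) ≤ ENNReal.ofReal A)
    (hB : ∀ n, ∫⁻ z, ENNReal.ofReal |z.2| ∂(μ n : Measure (ℝ × ℝ)) ≤ ENNReal.ofReal B)
    {c : ℂ × ℂ → ℂ} (hc : ∀ u : ℂ × ℂ, u.1.re = 0 → u.2.re = 0 →
      Tendsto (fun n => ∫ z, expPair u z ∂(μ n : Measure (ℝ × ℝ))) atTop (𝓝 (c u))) :
    ∃ ν : Measure (ℝ × ℝ), IsProbabilityMeasure ν ∧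
      (∀ u : ℂ × ℂ, u.1.re = 0 → u.2.re = 0 → ∫ z, expPair u z ∂ν = c u) ∧
      ∫⁻ z, ENNReal.ofReal |z.2| ∂ν ≤ ENNReal.ofReal B := by
  have htight : IsTightMeasureSet {((ρ : ProbabilityMeasure (ℝ × ℝ)) : Measure (ℝ × ℝ)) |
      ρ ∈ range μ} := by
    refine isTightMeasureSet_of_lintegral_le (A := A) (B := B) ?_ ?_
    · rintro _ ⟨_, ⟨n, rfl⟩, rfl⟩; exact hA n
    · rintro _ ⟨_, ⟨n, rfl⟩, rfl⟩; exact hB n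
  have hcomp := isCompact_closure_of_isTightMeasureSet htight
  set F : Ultrafilter ℕ := Ultrafilter.of atTop with hF
  have hFle : (F : Filter ℕ) ≤ atTop := Ultrafilter.of_le _
  obtain ⟨ν, -, hν⟩ := hcomp.ultrafilter_le_nhds (F.map μ) (by
    rw [le_principal_iff, Ultrafilter.mem_coe, Ultrafilter.mem_map]
    exact Filter.univ_mem' fun n => subset_closure (mem_range_self n))
  have hν' : Tendsto μ F (𝓝 ν) := hν
  refine ⟨ν, inferInstance, fun u h1 h2 => ?_, lintegral_ofReal_abs_snd_le_of_tendsto hν' hB⟩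
  exact tendsto_nhds_unique
    ((ProbabilityMeasure.tendsto_iff_forall_integral_rclike_tendsto ℂ).1 hν' (expPairBCF h1 h2))
    ((hc u h1 h2).mono_left hFle)

namespace AffineSemigroup

variable {S : AffineSemigroup}

lemma C2_nonneg (hb : 0 < 2 * S.b₂) (hba : 2 * S.b₂ < S.a₁) : 0 ≤ C2 S :=
  div_nonneg (abs_nonneg _) (by linarith)

lemma integral_snd_sq_approx_div_le (hba : 2 * S.b₂ < S.a₁) (n : ℕ) :
    (∫ z, z.2 ^ 2 ∂(S.approx n)) / (S.a₁ - 2 * S.b₂) ≤ C1 S := by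
  have hpos : 0 < S.a₁ - 2 * S.b₂ := by linarith
  have h := integral_snd_sq_approxLevy_le (α₁₁ := S.α₁₁) (α₁₂ := S.α₁₂) S.ae_m_nonneg
    S.integrable_levyWeight S.α₂₁_nonneg S.α₂₂_nonneg n
  have h11 : C11 S * (S.a₁ - 2 * S.b₂) = ∫ z, z.2 ^ 2 ∂S.m := by
    unfold C11; field_simp
  have h12 : C12 S * (S.a₁ - 2 * S.b₂) = 8 * max S.α₂₁ S.α₂₂ := by
    unfold C12; field_simp
  have h0 : 0 ≤ C11 S := mul_nonneg (inv_nonneg.2 hpos.le) (integral_nonneg fun z => sq_nonneg _)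
  have h1 := mul_le_mul_of_nonneg_right (le_max_left (C11 S) (C12 S)) hpos.le
  have h2 := mul_le_mul_of_nonneg_right (le_max_right (C11 S) (C12 S)) hpos.le
  have h3 := le_max_left S.α₂₁ S.α₂₂
  have h4 := le_max_right S.α₂₁ S.α₂₂
  have h5 := S.α₂₁_nonneg
  have h6 : 0 ≤ max (C11 S) (C12 S) * (S.a₁ - 2 * S.b₂) := by
    have := h0.trans (le_max_left (C11 S) (C12 S)); positivity
  rw [div_le_iff₀ hpos, C1]
  unfold approx
  linarith

/-- The law of the difference process: for `h ≥ 0` there is a probability measure with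
characteristic function `exp (h V₁(t, u))` and controlled first moment of the second coordinate. -/
lemma exists_difference_law (hb : 0 < 2 * S.b₂) (hba : 2 * S.b₂ < S.a₁) {t h : ℝ} (ht : 0 ≤ t)
    (hh : 0 ≤ h) :
    ∃ μ : Measure (ℝ × ℝ), IsProbabilityMeasure μ ∧
      (∀ u : ℂ × ℂ, u.1.re = 0 → u.2.re = 0 →
        ∫ z, expPair u z ∂μ = Complex.exp (h * S.V₁ t u)) ∧
      ∫⁻ z, ENNReal.ofReal |z.2| ∂μ ≤ ENNReal.ofReal
        (Real.exp (-S.b₂ * t) * (C2 S * h + Real.sqrt (C1 S * h))) := by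
  set A : ℕ → ℝ := fun n => S.a₁ + ∫ z, z.1 ∂(S.approx n) with hAdef
  set N : ℕ → ℕ := fun n => max (n + 1) ⌈t * A n⌉₊ with hNdef
  have hN : ∀ n, n + 1 ≤ N n := fun n => le_max_left _ _
  have hNpos : ∀ n, (0 : ℝ) < N n := fun n => by exact_mod_cast (Nat.succ_pos n).trans_le (hN n)
  have hsA : ∀ n, t / N n * (S.a₁ + ∫ z, z.1 ∂(S.approx n)) ≤ 1 := by
    intro n
    rw [div_mul_eq_mul_div, div_le_one (hNpos n)]
    refine (Nat.le_ceil (t * A n)).trans ?_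
    exact_mod_cast le_max_right _ _
  have hchain : ∀ n, ∃ μ : ProbabilityMeasure (ℝ × ℝ),
      (∀ u : ℂ × ℂ, u.1.re = 0 → u.2.re = 0 → ∫ z, expPair u z ∂(μ : Measure (ℝ × ℝ))
        = Complex.exp
          (h * ((eulerStep S.a₁ S.b₁ S.b₂ (S.approx n) (t / N n))^[N n] u).1)) ∧
      ∫⁻ z, ENNReal.ofReal |z.1| ∂(μ : Measure (ℝ × ℝ)) ≤ ENNReal.ofReal h ∧
      ∫⁻ z, ENNReal.ofReal |z.2| ∂(μ : Measure (ℝ × ℝ)) ≤ ENNReal.ofReal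
        (Real.exp (-S.b₂ * t) * (C2 S * h + Real.sqrt (C1 S * h))) := by
    intro n
    obtain ⟨hfin, hi1, hi2, hq1, hq2⟩ := integrable_approx (S := S) n
    have hs : 0 ≤ t / N n := div_nonneg ht (hNpos n).le
    obtain ⟨ν, hν, hpos, hchar, hx1, hx2, hx3⟩ := exists_chain (b₁ := S.b₁)
      (ae_approx_nonneg n) hi1 hi2 hq1 hq2 hs hh (hsA n) hb hba (N n)
    have hmeas : Measurable fun x : ℝ × ℝ × ℝ => (x.1, x.2.1 + x.2.2) := by fun_prop
    have hInt : 0 ≤ ∫ z, z.1 ∂(S.approx n) := integral_nonneg_of_ae (ae_approx_nonneg n)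
    have ha : 0 ≤ S.a₁ := by linarith
    have hq0 : 0 ≤ 1 - t / N n * S.a₁ := by
      have := hsA n
      have := mul_nonneg hs hInt
      nlinarith
    have hq1' : 1 - t / N n * S.a₁ ≤ 1 := by
      have := mul_nonneg hs ha
      linarith
    have hqN0 : 0 ≤ (1 - t / N n * S.a₁) ^ N n := pow_nonneg hq0 _
    have hqN1 : (1 - t / N n * S.a₁) ^ N n ≤ 1 := pow_le_one₀ hq0 hq1'
    have he : Real.exp (-S.b₂ * (t / N n)) ^ N n = Real.exp (-S.b₂ * t) := by
      rw [← Real.exp_nat_mul]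
      congr 1
      have := (hNpos n).ne'
      field_simp
    have he2 : (Real.exp (-S.b₂ * (t / N n)) ^ 2) ^ N n = Real.exp (-S.b₂ * t) ^ 2 := by
      rw [← pow_mul, mul_comm 2, pow_mul, he]
    have hC1 : 0 ≤ C1 S := le_trans (div_nonneg (integral_nonneg fun z => sq_nonneg _)
      (by linarith)) (integral_snd_sq_approx_div_le hba n)
    refine ⟨⟨ν.map fun x => (x.1, x.2.1 + x.2.2),
      Measure.isProbabilityMeasure_map hmeas.aemeasurable⟩, fun u h1 h2 => ?_, ?_, ?_⟩
    · rw [← hchar u h1.le h2]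
      exact integral_map hmeas.aemeasurable (measurable_expPair u).aestronglyMeasurable
    · rw [ProbabilityMeasure.coe_mk, lintegral_map (by fun_prop) hmeas]
      refine le_trans (le_of_eq (lintegral_congr_ae ?_))
        (hx1.trans (ENNReal.ofReal_le_ofReal (mul_le_of_le_one_right hh hqN1)))
      filter_upwards [hpos] with x hx
      rw [abs_of_nonneg hx]
    · rw [ProbabilityMeasure.coe_mk, lintegral_map (by fun_prop) hmeas]
      have h2 : ∫⁻ x, ENNReal.ofReal |x.2.1| ∂ν
          ≤ ENNReal.ofReal (Real.exp (-S.b₂ * t) * (C2 S * h)) := by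
        refine hx2.trans (ENNReal.ofReal_le_ofReal ?_)
        rw [he]
        have h3 : h * |S.b₁| / (S.a₁ - S.b₂) = C2 S * h := by unfold C2; ring
        rw [h3, mul_comm (Real.exp _)]
        exact mul_le_mul_of_nonneg_left (by linarith) (mul_nonneg (C2_nonneg hb hba) hh)
      have h3 : ∫⁻ x, ENNReal.ofReal |x.2.2| ∂ν
          ≤ ENNReal.ofReal (Real.exp (-S.b₂ * t) * Real.sqrt (C1 S * h)) := by
        rw [show Real.exp (-S.b₂ * t) * Real.sqrt (C1 S * h)
          = Real.sqrt (Real.exp (-S.b₂ * t) ^ 2 * (C1 S * h)) by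
            rw [Real.sqrt_mul (sq_nonneg _), Real.sqrt_sq (Real.exp_pos _).le]]
        refine lintegral_ofReal_abs_le_sqrt (by fun_prop) (by positivity)
          (hx3.trans (ENNReal.ofReal_le_ofReal ?_))
        rw [he2, mul_comm (Real.exp _ ^ 2)]
        refine mul_le_mul ?_ (by linarith) ?_ (by positivity)
        · rw [mul_div_assoc, mul_comm (C1 S)]
          exact mul_le_mul_of_nonneg_left (integral_snd_sq_approx_div_le hba n) hh
        · rw [← he2, sub_nonneg]
          refine pow_le_pow_left₀ hq0 ?_ _
          rw [← Real.exp_nat_mul]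
          refine le_trans ?_ (Real.add_one_le_exp _)
          push_cast
          nlinarith
      calc ∫⁻ x, ENNReal.ofReal |x.2.1 + x.2.2| ∂ν
          ≤ ∫⁻ x, (ENNReal.ofReal |x.2.1| + ENNReal.ofReal |x.2.2|) ∂ν := by
            refine lintegral_mono fun x => ?_
            rw [← ENNReal.ofReal_add (abs_nonneg _) (abs_nonneg _)]
            exact ENNReal.ofReal_le_ofReal (abs_add_le _ _)
        _ = ∫⁻ x, ENNReal.ofReal |x.2.1| ∂ν + ∫⁻ x, ENNReal.ofReal |x.2.2| ∂ν :=
            lintegral_add_left (by fun_prop) _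
        _ ≤ _ := by
            rw [mul_add, ENNReal.ofReal_add (mul_nonneg (Real.exp_pos _).le
              (mul_nonneg (C2_nonneg hb hba) hh)) (by positivity)]
            exact add_le_add h2 h3
  choose μ hchar hfst hsnd using hchain
  refine exists_limit_law hfst hsnd fun u h1 h2 => ?_
  simp_rw [fun n => hchar n u h1 h2]
  exact (Complex.continuous_exp.tendsto _).comp
    ((tendsto_eulerStep hb ht hN hsA h1.le h2).const_mul _)

end AffineSemigroup

lemma ext_of_integral_expPair {μ ν : Measure (ℝ × ℝ)} [IsFiniteMeasure μ] [IsFiniteMeasure ν]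
    (h : ∀ u : ℂ × ℂ, u.1.re = 0 → u.2.re = 0 → ∫ z, expPair u z ∂μ = ∫ z, expPair u z ∂ν) :
    μ = ν := by
  refine Measure.ext_of_charFunDual (funext fun L => ?_)
  have hL : ∀ z : ℝ × ℝ, Complex.exp (L z * Complex.I)
      = expPair (L (1, 0) * Complex.I, L (0, 1) * Complex.I) z := by
    intro z
    have hz : L z = z.1 * L (1, 0) + z.2 * L (0, 1) := by
      conv_lhs => rw [show z = z.1 • ((1 : ℝ), (0 : ℝ)) + z.2 • ((0 : ℝ), (1 : ℝ)) by
        ext <;> simp]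
      rw [map_add, map_smul, map_smul, smul_eq_mul, smul_eq_mul]
    rw [hz, expPair]
    push_cast
    ring_nf
  rw [charFunDual_apply, charFunDual_apply]
  simp_rw [hL]
  exact h _ (by simp) (by simp)

namespace AffineSemigroup

variable {S : AffineSemigroup}

lemma exists_coupling_of_le (hb : 0 < 2 * S.b₂) (hba : 2 * S.b₂ < S.a₁) {t : ℝ} (ht : 0 ≤ t)
    {x y : ℝ × ℝ} (hy : 0 ≤ y.1) (hxy : y.1 ≤ x.1) :
    ∃ Q : Measure ((ℝ × ℝ) × (ℝ × ℝ)), IsProbabilityMeasure Q ∧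
      Q.map Prod.fst = S.P t x ∧ Q.map Prod.snd = S.P t y ∧
      ∫⁻ p, ENNReal.ofReal |p.1.2 - p.2.2| ∂Q ≤ ENNReal.ofReal (Real.exp (-S.b₂ * t)
        * (|x.2 - y.2| + C2 S * |x.1 - y.1| + Real.sqrt (C1 S * |x.1 - y.1|))) := by
  have hh : 0 ≤ x.1 - y.1 := sub_nonneg.2 hxy
  obtain ⟨μ, hμ, hchar, hmom⟩ := exists_difference_law hb hba ht hh
  have := S.P_prob t ht x (hy.trans hxy)
  have := S.P_prob t ht y hy
  set c : ℝ × ℝ := (0, Real.exp (-S.b₂ * t) * (x.2 - y.2)) with hc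
  have hmeas : Measurable fun p : (ℝ × ℝ) × (ℝ × ℝ) => (p.1 + p.2 + c, p.1) := by fun_prop
  have hQ : IsProbabilityMeasure
      (((S.P t y).prod μ).map fun p : (ℝ × ℝ) × (ℝ × ℝ) => (p.1 + p.2 + c, p.1)) :=
    Measure.isProbabilityMeasure_map hmeas.aemeasurable
  refine ⟨((S.P t y).prod μ).map fun p => (p.1 + p.2 + c, p.1), hQ, ?_, ?_, ?_⟩
  · have := Measure.isProbabilityMeasure_map
      (μ := ((S.P t y).prod μ).map fun p : (ℝ × ℝ) × (ℝ × ℝ) => (p.1 + p.2 + c, p.1))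
      (f := Prod.fst) measurable_fst.aemeasurable
    refine ext_of_integral_expPair fun u h1 h2 => ?_
    rw [Measure.map_map measurable_fst hmeas,
      integral_map (measurable_fst.comp hmeas).aemeasurable
        (measurable_expPair u).aestronglyMeasurable]
    simp only [Function.comp_apply, expPair_add]
    rw [integral_mul_const, integral_prod_mul, hchar u h1 h2]
    have hPx := S.P_char t ht x (hy.trans hxy) u h1 h2
    have hPy := S.P_char t ht y hy u h1 h2
    simp only [expPair]
    rw [hPx, hPy, ← Complex.exp_add, ← Complex.exp_add]
    congr 1
    simp only [hc]
    push_cast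
    ring
  · rw [Measure.map_map measurable_snd hmeas]
    exact Measure.fst_prod
  · rw [lintegral_map (by fun_prop) hmeas]
    have hE := Real.exp_pos (-S.b₂ * t)
    have hle : ∀ p : (ℝ × ℝ) × (ℝ × ℝ), ENNReal.ofReal |(p.1 + p.2 + c).2 - p.1.2|
        ≤ ENNReal.ofReal |p.2.2| + ENNReal.ofReal (Real.exp (-S.b₂ * t) * |x.2 - y.2|) := by
      intro p
      rw [← ENNReal.ofReal_add (abs_nonneg _) (by positivity)]
      refine ENNReal.ofReal_le_ofReal ?_
      rw [show (p.1 + p.2 + c).2 - p.1.2 = p.2.2 + Real.exp (-S.b₂ * t) * (x.2 - y.2) by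
        simp [hc]; ring]
      refine (abs_add_le _ _).trans_eq ?_
      rw [abs_mul, abs_of_pos hE]
    refine (lintegral_mono hle).trans ?_
    rw [lintegral_add_left (by fun_prop), lintegral_const, measure_univ, mul_one]
    have hsnd : ∫⁻ p : (ℝ × ℝ) × (ℝ × ℝ), ENNReal.ofReal |p.2.2| ∂((S.P t y).prod μ)
        = ∫⁻ z, ENNReal.ofReal |z.2| ∂μ := by
      rw [← lintegral_map (f := fun z : ℝ × ℝ => ENNReal.ofReal |z.2|) (by fun_prop) measurable_snd]
      exact congrArg (fun ρ : Measure (ℝ × ℝ) => ∫⁻ z, ENNReal.ofReal |z.2| ∂ρ) Measure.snd_prod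
    rw [hsnd, abs_of_nonneg hh]
    have hC2 := mul_nonneg (C2_nonneg hb hba) hh
    refine (add_le_add_left hmom _).trans_eq ?_
    rw [← ENNReal.ofReal_add (by positivity) (by positivity)]
    ring_nf

lemma exists_coupling (hb : 0 < 2 * S.b₂) (hba : 2 * S.b₂ < S.a₁) {t : ℝ} (ht : 0 ≤ t)
    {x y : ℝ × ℝ} (hx : 0 ≤ x.1) (hy : 0 ≤ y.1) :
    ∃ Q : Measure ((ℝ × ℝ) × (ℝ × ℝ)), IsProbabilityMeasure Q ∧
      Q.map Prod.fst = S.P t x ∧ Q.map Prod.snd = S.P t y ∧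
      ∫⁻ p, ENNReal.ofReal |p.1.2 - p.2.2| ∂Q ≤ ENNReal.ofReal (Real.exp (-S.b₂ * t)
        * (|x.2 - y.2| + C2 S * |x.1 - y.1| + Real.sqrt (C1 S * |x.1 - y.1|))) := by
  rcases le_total y.1 x.1 with h | h
  · exact exists_coupling_of_le hb hba ht hy h
  · obtain ⟨Q, hQ, h1, h2, h3⟩ := exists_coupling_of_le hb hba ht hx h
    refine ⟨Q.map Prod.swap, Measure.isProbabilityMeasure_map measurable_swap.aemeasurable,
      ?_, ?_, ?_⟩
    · rw [Measure.map_map measurable_fst measurable_swap]; exact h2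
    · rw [Measure.map_map measurable_snd measurable_swap]; exact h1
    · rw [lintegral_map (by fun_prop) measurable_swap, abs_sub_comm x.2, abs_sub_comm x.1]
      refine le_of_eq_of_le (lintegral_congr fun p => ?_) h3
      rw [Prod.fst_swap, Prod.snd_swap, abs_sub_comm]

end AffineSemigroup

/-- Lemma 3.1: the coupling estimate for the second coordinate. -/
theorem coupling_second_coordinate
    (S : AffineSemigroup)
    (hb : 0 < 2 * S.b₂) (hba : 2 * S.b₂ < S.a₁) :
    ∀ t ≥ (0:ℝ), ∀ x y : ℝ × ℝ, 0 ≤ x.1 → 0 ≤ y.1 →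
      ∃ Q : Measure ((ℝ × ℝ) × (ℝ × ℝ)), IsProbabilityMeasure Q ∧
        Q.map Prod.fst = S.P t x ∧ Q.map Prod.snd = S.P t y ∧
        (∫ p : (ℝ × ℝ) × (ℝ × ℝ), |p.1.2 - p.2.2| ∂Q
          ≤ Real.exp (-S.b₂ * t)
              * (|x.2 - y.2| + C2 S * |x.1 - y.1|
                  + Real.sqrt (C1 S * |x.1 - y.1|))) ∧
        ∀ η > (0:ℝ),
          Q {p : (ℝ × ℝ) × (ℝ × ℝ) | Real.exp (-S.b₂ * t) * η < |p.1.2 - p.2.2|}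
            ≤ ENNReal.ofReal (η⁻¹ * (|x.2 - y.2| + C2 S * |x.1 - y.1|
                + Real.sqrt (C1 S * |x.1 - y.1|))) := by
  intro t ht x y hx hy
  obtain ⟨Q, hQ, h1, h2, h3⟩ := AffineSemigroup.exists_coupling hb hba ht hx hy
  have hC2 := AffineSemigroup.C2_nonneg hb hba
  have hE := Real.exp_pos (-S.b₂ * t)
  refine ⟨Q, hQ, h1, h2, ?_, fun η hη => ?_⟩
  · rw [integral_eq_lintegral_of_nonneg_ae (Eventually.of_forall fun p => abs_nonneg _)
      (by fun_prop)]
    exact ENNReal.toReal_le_of_le_ofReal (by positivity) h3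
  · have hpos : 0 < Real.exp (-S.b₂ * t) * η := mul_pos hE hη
    calc _ ≤ Q {p | ENNReal.ofReal (Real.exp (-S.b₂ * t) * η)
            ≤ ENNReal.ofReal |p.1.2 - p.2.2|} :=
          measure_mono fun p hp => ENNReal.ofReal_le_ofReal (le_of_lt hp)
      _ ≤ (∫⁻ p, ENNReal.ofReal |p.1.2 - p.2.2| ∂Q)
            / ENNReal.ofReal (Real.exp (-S.b₂ * t) * η) :=
          meas_ge_le_lintegral_div (by fun_prop) (by simpa using hpos) ENNReal.ofReal_ne_top
      _ ≤ _ := (ENNReal.div_le_div_right h3 _).trans_eq (by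
          rw [← ENNReal.ofReal_div_of_pos hpos]
          congr 1
          field_simp)

end AffinePaper
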